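/- Let (a,b) be a bounded interval and let m be a bounded C² function on (a,b) such that (ξ−a)^k (b−ξ)^k |m^{(k)}(ξ)| ≤ c for all ξ ∈ (a,b) and k = 0, 1, 2, for some constant c > 0. Then the operator T_m^{a,b}, defined on ℓ^2(ℤ) by T_m^{a,b}(f)(n) = ∫_0^1 m(a + (b−a)ξ) F(f)(ξ) e^{2πi nξ} dξ, is bounded from ℓ^p(ℤ) to ℓ^p(ℤ) for all 1 < p < ∞. -/

import Mathlib

open MeasureTheory Real Complex

/-- Discrete Fourier transform on `ℤ`: `F(f)(ξ) = ∑_{n ∈ ℤ} f(n) e^{2πi nξ}`. -/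
noncomputable def dftZ (f : ℤ → ℂ) (ξ : ℝ) : ℂ :=
  ∑' n : ℤ, f n * Complex.exp (2 * Real.pi * Complex.I * (n : ℂ) * (ξ : ℂ))

/-- The multiplier operator adapted to the interval `(a,b)`:
`T_m^{a,b}(f)(n) = ∫_0^1 m(a + (b−a)ξ) F(f)(ξ) e^{2πi nξ} dξ`. -/
noncomputable def TmultInterval (a b : ℝ) (m : ℝ → ℂ) (f : ℤ → ℂ) (n : ℤ) : ℂ :=
  ∫ ξ in Set.Ioo (0 : ℝ) 1, m (a + (b - a) * ξ) * dftZ f ξ *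
    Complex.exp (2 * Real.pi * Complex.I * (n : ℂ) * (ξ : ℂ))

/-- The `ℓ^p(ℤ)` norm, as the `L^p` norm with respect to counting measure. -/
noncomputable def lpNormZ (f : ℤ → ℂ) (p : ℝ) : ENNReal :=
  eLpNorm f (ENNReal.ofReal p) (Measure.count : Measure ℤ)

open scoped ENNReal NNReal

/-- Convolution of finitely supported functions on `ℤ` with the kernel `K`. -/
noncomputable def convZ (K : ℤ → ℂ) : (ℤ →₀ ℂ) →ₗ[ℂ] (ℤ → ℂ) :=
  Finsupp.linearCombination ℂ (fun k n => K (n - k))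

theorem convZ_apply (K : ℤ → ℂ) (f : ℤ →₀ ℂ) (n : ℤ) :
    convZ K f n = f.sum fun k z => z * K (n - k) := by
  simp [convZ, Finsupp.linearCombination_apply, Finsupp.sum, Finset.sum_apply]

/-- Hörmander's condition with constant `B` for a kernel on `ℤ`. -/
def HormanderZ (K : ℤ → ℂ) (B : ℝ≥0) : Prop :=
  ∀ L : ℕ, 0 < L → ∀ y : ℤ, 0 ≤ y → y < L →
    ∑' n : ℤ, {n : ℤ | 2 * (L : ℤ) ≤ |n|}.indicator (fun n => ‖K (n - y) - K n‖ₑ) n ≤ B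

/-- `ℓ²` boundedness, with squared constant `A`, of convolution with `K`. -/
def L2BoundedZ (K : ℤ → ℂ) (A : ℝ≥0) : Prop :=
  ∀ f : ℤ →₀ ℂ, ∑' n : ℤ, ‖convZ K f n‖ₑ ^ 2 ≤ A * ∑' n : ℤ, ‖f n‖ₑ ^ 2

theorem tsum_enorm_finsupp (f : ℤ →₀ ℂ) : ∑' n, ‖f n‖ₑ = ∑ n ∈ f.support, ‖f n‖ₑ :=
  tsum_eq_sum fun n hn => by simpa using hn

theorem tsum_convZ_of_mean_zero {K : ℤ → ℂ} {B : ℝ≥0} (hK : HormanderZ K B) {L : ℕ} (hL : 0 < L)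
    (c : ℤ) (b : ℤ →₀ ℂ) (hb : b.support ⊆ Finset.Ico c (c + L)) (hb0 : ∑ k ∈ b.support, b k = 0) :
    ∑' n, ((Finset.Ioo (c - 2 * L) (c + 2 * L) : Finset ℤ) : Set ℤ)ᶜ.indicator
      (fun n => ‖convZ K b n‖ₑ) n ≤ B * ∑' n, ‖b n‖ₑ := by
  set E : Set ℤ := ((Finset.Ioo (c - 2 * L) (c + 2 * L) : Finset ℤ) : Set ℤ)ᶜ with hE
  have h1 : ∀ n, convZ K b n = ∑ k ∈ b.support, b k * (K (n - k) - K (n - c)) := by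
    intro n
    simp only [mul_sub, Finset.sum_sub_distrib, ← Finset.sum_mul, hb0, convZ_apply, Finsupp.sum]
    simp
  have h2 : ∀ n, E.indicator (fun n => ‖convZ K b n‖ₑ) n ≤
      ∑ k ∈ b.support, ‖b k‖ₑ * E.indicator (fun n => ‖K (n - k) - K (n - c)‖ₑ) n := by
    intro n
    by_cases hn : n ∈ E
    · simp only [Set.indicator_of_mem hn]
      rw [h1]
      refine (enorm_sum_le _ _).trans (Finset.sum_le_sum fun k _ => ?_)
      rw [enorm_mul]
    · simp [Set.indicator_of_notMem hn]
  refine (ENNReal.tsum_le_tsum h2).trans ?_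
  rw [Summable.tsum_finsetSum (fun _ _ => ENNReal.summable), tsum_enorm_finsupp, Finset.mul_sum]
  refine Finset.sum_le_sum fun k hk => ?_
  rw [ENNReal.tsum_mul_left, mul_comm]
  gcongr
  have hk' := Finset.mem_Ico.1 (hb hk)
  refine le_trans (le_of_eq ?_) (hK L hL (k - c) (by omega) (by omega))
  rw [← (Equiv.subRight c).tsum_eq ({n : ℤ | 2 * (L : ℤ) ≤ |n|}.indicator _)]
  refine tsum_congr fun n => ?_
  have h3 : (Equiv.subRight c n ∈ {n : ℤ | 2 * (L : ℤ) ≤ |n|}) ↔ n ∈ E := by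
    simp only [hE, Equiv.subRight_apply, Set.mem_ofPred_eq, Set.mem_compl_iff, Finset.coe_Ioo,
      Set.mem_Ioo, le_abs]
    omega
  by_cases hn : n ∈ E
  · rw [Set.indicator_of_mem hn, Set.indicator_of_mem (h3.2 hn)]
    simp
  · rw [Set.indicator_of_notMem hn, Set.indicator_of_notMem (fun h => hn (h3.1 h))]

/-- A decomposition of `f` into a good and a bad part at height `t`, recording the bounds
that the good part, the exceptional set and the convolution of the bad part satisfy. -/
def HasCZDecomp (K : ℤ → ℂ) (B t : ℝ≥0) (I : Finset ℤ) (f : ℤ →₀ ℂ) : Prop :=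
  ∃ (g b : ℤ →₀ ℂ) (E : Finset ℤ), f = g + b ∧ g.support ⊆ I ∧ (∀ n, ‖g n‖ₑ ≤ 2 * t) ∧
    ∑' n, ‖g n‖ₑ ≤ ∑' n, ‖f n‖ₑ ∧ t * (E.card : ℝ≥0∞) ≤ 4 * ∑' n, ‖f n‖ₑ ∧
    ∑' n, (E : Set ℤ)ᶜ.indicator (fun n => ‖convZ K b n‖ₑ) n ≤ 2 * B * ∑' n, ‖f n‖ₑ

theorem HasCZDecomp.of_large_average {K : ℤ → ℂ} {B : ℝ≥0} (hK : HormanderZ K B) (t : ℝ≥0)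
    {L : ℕ} (hL : 0 < L) (c : ℤ) (f : ℤ →₀ ℂ) (hf : f.support ⊆ Finset.Ico c (c + L))
    (h₁ : t * (L : ℝ≥0∞) ≤ ∑' n, ‖f n‖ₑ) (h₂ : ∑' n, ‖f n‖ₑ ≤ 2 * t * L) :
    HasCZDecomp K B t (Finset.Ico c (c + L)) f := by
  set I := Finset.Ico c (c + L) with hI
  have hIc : I.card = L := by simp [hI]
  set v : ℂ := (∑ k ∈ f.support, f k) / L with hv
  have hL0 : (L : ℂ) ≠ 0 := by exact_mod_cast hL.ne'
  have hL1 : (L : ℝ≥0∞) ≠ 0 := by exact_mod_cast hL.ne'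
  have hvn : ‖v‖ₑ * L ≤ ∑' n, ‖f n‖ₑ := by
    have : v * L = ∑ k ∈ f.support, f k := by rw [hv]; field_simp
    have h : ‖v‖ₑ * L = ‖v * L‖ₑ := by rw [enorm_mul]; congr 1; simp [enorm_eq_nnnorm]
    rw [h, this, tsum_enorm_finsupp]
    exact enorm_sum_le _ _
  let g : ℤ →₀ ℂ := Finsupp.indicator I (fun _ _ => v)
  have hg : ∀ n, g n = if n ∈ I then v else 0 := by
    intro n; simp [g, Finsupp.indicator_apply]
  have hgs : g.support ⊆ I := Finsupp.support_indicator_subset _ _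
  have hgn : ∑' n, ‖g n‖ₑ ≤ ∑' n, ‖f n‖ₑ := by
    refine le_trans (le_of_eq ?_) hvn
    rw [tsum_eq_sum (s := I) (fun n hn => by simp [hg, hn]),
      Finset.sum_congr rfl (fun n hn => by rw [hg, if_pos hn])]
    simp [hIc, mul_comm]
  refine ⟨g, f - g, Finset.Ioo (c - 2 * L) (c + 2 * L), by abel, hgs, ?_, hgn, ?_, ?_⟩
  · intro n
    rw [hg]
    split_ifs
    · refine (ENNReal.mul_le_mul_iff_left hL1 (by simp)).1 (hvn.trans h₂)
    · simp
  · have : ((Finset.Ioo (c - 2 * L) (c + 2 * L)).card : ℝ≥0∞) ≤ 4 * L := by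
      have : (Finset.Ioo (c - 2 * L) (c + 2 * L)).card ≤ 4 * L := by
        rw [Int.card_Ioo]; omega
      exact_mod_cast this
    calc t * ((Finset.Ioo (c - 2 * L) (c + 2 * L)).card : ℝ≥0∞) ≤ t * (4 * L) := by gcongr
      _ = 4 * (t * L) := by ring
      _ ≤ _ := by gcongr
  · have hbs : (f - g).support ⊆ I := by
      exact (Finsupp.support_sub).trans (Finset.union_subset hf hgs)
    refine (tsum_convZ_of_mean_zero hK hL c (f - g) hbs ?_).trans ?_
    · rw [Finset.sum_subset hbs (fun n _ hn => by simpa using hn)]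
      simp only [Finsupp.sub_apply, Finset.sum_sub_distrib]
      have hgI : ∑ n ∈ I, g n = L * v := by
        rw [Finset.sum_congr rfl (g := fun _ => v) (fun n hn => by rw [hg, if_pos hn])]
        simp [hIc]
      rw [hgI, ← Finset.sum_subset hf (fun n _ hn => by simpa using hn), hv]
      field_simp
      simp
    · rw [mul_comm 2 (B : ℝ≥0∞), mul_assoc]
      gcongr
      calc ∑' n, ‖(f - g) n‖ₑ ≤ ∑' n, (‖f n‖ₑ + ‖g n‖ₑ) :=
            ENNReal.tsum_le_tsum fun n => enorm_sub_le
        _ ≤ _ := by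
            rw [ENNReal.tsum_add, two_mul]; gcongr

theorem tsum_enorm_add_of_disjoint {f g : ℤ →₀ ℂ} (h : ∀ n, f n = 0 ∨ g n = 0) :
    ∑' n, ‖(f + g) n‖ₑ = ∑' n, ‖f n‖ₑ + ∑' n, ‖g n‖ₑ := by
  rw [← ENNReal.tsum_add]
  refine tsum_congr fun n => ?_
  rcases h n with h | h <;> simp [h]

theorem HasCZDecomp.add {K : ℤ → ℂ} {B t : ℝ≥0} {I J : Finset ℤ} (hIJ : Disjoint I J)
    {f₁ f₂ : ℤ →₀ ℂ} (hf₁ : f₁.support ⊆ I) (hf₂ : f₂.support ⊆ J)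
    (h₁ : HasCZDecomp K B t I f₁) (h₂ : HasCZDecomp K B t J f₂) :
    HasCZDecomp K B t (I ∪ J) (f₁ + f₂) := by
  have key : ∀ {u v : ℤ →₀ ℂ}, u.support ⊆ I → v.support ⊆ J → ∀ n, u n = 0 ∨ v n = 0 := by
    intro u v hu hv n
    by_contra! h
    exact Finset.disjoint_left.1 hIJ (hu (Finsupp.mem_support_iff.2 h.1))
      (hv (Finsupp.mem_support_iff.2 h.2))
  obtain ⟨g₁, b₁, E₁, he₁, hs₁, hb₁, hn₁, hE₁, hT₁⟩ := h₁
  obtain ⟨g₂, b₂, E₂, he₂, hs₂, hb₂, hn₂, hE₂, hT₂⟩ := h₂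
  rw [HasCZDecomp, tsum_enorm_add_of_disjoint (key hf₁ hf₂)]
  refine ⟨g₁ + g₂, b₁ + b₂, E₁ ∪ E₂, by rw [he₁, he₂]; abel,
    Finsupp.support_add.trans (Finset.union_subset_union hs₁ hs₂), ?_, ?_, ?_, ?_⟩
  · intro n
    rcases key hs₁ hs₂ n with h | h
    · simpa [h] using hb₂ n
    · simpa [h] using hb₁ n
  · rw [tsum_enorm_add_of_disjoint (key hs₁ hs₂)]
    gcongr
  · rw [mul_add]
    refine le_trans ?_ (add_le_add hE₁ hE₂)
    rw [← mul_add]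
    gcongr
    exact_mod_cast Finset.card_union_le _ _
  · rw [mul_add]
    refine le_trans ?_ (add_le_add hT₁ hT₂)
    rw [← ENNReal.tsum_add]
    refine ENNReal.tsum_le_tsum fun n => ?_
    by_cases hn : n ∈ ((E₁ ∪ E₂ : Finset ℤ) : Set ℤ)ᶜ
    · have hn1 : n ∈ (E₁ : Set ℤ)ᶜ := fun h => hn (by simp at h; simp [h])
      have hn2 : n ∈ (E₂ : Set ℤ)ᶜ := fun h => hn (by simp at h; simp [h])
      rw [Set.indicator_of_mem hn, Set.indicator_of_mem hn1, Set.indicator_of_mem hn2, map_add]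
      exact enorm_add_le _ _
    · rw [Set.indicator_of_notMem hn]; exact zero_le

theorem hasCZDecomp_dyadic {K : ℤ → ℂ} {B : ℝ≥0} (hK : HormanderZ K B) (t : ℝ≥0) (j : ℕ) :
    ∀ (c : ℤ) (f : ℤ →₀ ℂ), f.support ⊆ Finset.Ico c (c + (2 ^ j : ℕ)) →
      ∑' n, ‖f n‖ₑ ≤ t * (2 ^ j : ℕ) → HasCZDecomp K B t (Finset.Ico c (c + (2 ^ j : ℕ))) f := by
  induction j with
  | zero =>
    intro c f hf h
    refine ⟨f, 0, ∅, by simp, hf, fun n => ?_, le_rfl, by simp, by simp⟩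
    refine (ENNReal.le_tsum n).trans (h.trans ?_)
    simp only [pow_zero, Nat.cast_one, mul_one]
    exact le_mul_of_one_le_left zero_le (by norm_num)
  | succ j ih =>
    intro c f hf h
    set L : ℕ := 2 ^ j with hL
    have hL0 : 0 < L := by positivity
    have h2 : (2 ^ (j + 1) : ℕ) = L + L := by rw [pow_succ]; ring
    rw [h2] at hf h ⊢
    have half : ∀ (c : ℤ) (f : ℤ →₀ ℂ), f.support ⊆ Finset.Ico c (c + L) →
        ∑' n, ‖f n‖ₑ ≤ t * (L + L : ℕ) → HasCZDecomp K B t (Finset.Ico c (c + L)) f := by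
      intro c f hf h
      rcases le_total (∑' n, ‖f n‖ₑ) (t * (L : ℝ≥0∞)) with h' | h'
      · exact ih c f hf h'
      · refine .of_large_average hK t hL0 c f hf h' (h.trans (le_of_eq ?_))
        push_cast
        ring
    have hle : ∀ p : ℤ → Prop, ∀ [DecidablePred p],
        ∑' n, ‖f.filter p n‖ₑ ≤ ∑' n, ‖f n‖ₑ := by
      intro p _
      refine ENNReal.tsum_le_tsum fun n => ?_
      rw [Finsupp.filter_apply]
      split_ifs <;> simp
    have hs₁ : (f.filter (· < c + L)).support ⊆ Finset.Ico c (c + L) := by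
      intro n hn
      simp only [Finsupp.support_filter, Finset.mem_filter] at hn
      have := Finset.mem_Ico.1 (hf hn.1)
      simp only [Finset.mem_Ico]; omega
    have hs₂ : (f.filter (¬ · < c + L)).support ⊆ Finset.Ico (c + L) (c + L + L) := by
      intro n hn
      simp only [Finsupp.support_filter, Finset.mem_filter] at hn
      have := Finset.mem_Ico.1 (hf hn.1)
      simp only [Finset.mem_Ico]; push_cast at this; omega
    have hu : Finset.Ico c (c + (L + L : ℕ)) =
        Finset.Ico c (c + L) ∪ Finset.Ico (c + L) (c + L + L) := by
      rw [Finset.Ico_union_Ico_eq_Ico (by omega) (by omega)]; push_cast; rw [add_assoc]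
    rw [hu, ← Finsupp.filter_add_filter_not f (· < c + (L : ℤ))]
    refine .add (Finset.Ico_disjoint_Ico_consecutive _ _ _) hs₁ hs₂
      (half _ _ hs₁ ((hle _).trans h)) (half _ _ hs₂ ((hle _).trans h))

theorem exists_hasCZDecomp {K : ℤ → ℂ} {B : ℝ≥0} (hK : HormanderZ K B) {t : ℝ≥0} (ht : 0 < t)
    (f : ℤ →₀ ℂ) : ∃ I, HasCZDecomp K B t I f := by
  obtain ⟨N, hN⟩ : ∃ N : ℕ, ∀ n ∈ f.support, n.natAbs ≤ N :=
    ⟨f.support.sup Int.natAbs, fun n hn => Finset.le_sup (f := Int.natAbs) hn⟩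
  obtain ⟨R, hR⟩ : ∃ R : ℕ, ∑ n ∈ f.support, ‖f n‖₊ / t ≤ R := exists_nat_ge _
  obtain ⟨j, hj⟩ : ∃ j : ℕ, 2 * N + 1 + R ≤ 2 ^ j := ⟨_, Nat.lt_two_pow_self.le⟩
  refine ⟨_, hasCZDecomp_dyadic hK t j (-N) f ?_ ?_⟩
  · intro n hn
    have := hN n hn
    rw [Finset.mem_Ico]
    omega
  · rw [tsum_enorm_finsupp]
    have h1 : ∑ n ∈ f.support, ‖f n‖₊ ≤ t * (2 ^ j : ℕ) := by
      rw [← Finset.sum_div, div_le_iff₀ ht] at hR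
      refine hR.trans ?_
      rw [mul_comm]
      gcongr
      omega
    simp only [enorm_eq_nnnorm]
    exact_mod_cast h1

theorem mul_count_le_tsum (F : ℤ → ℝ≥0∞) (t : ℝ≥0∞) :
    t * Measure.count {n | t < F n} ≤ ∑' n, F n := by
  rw [← lintegral_count]
  refine le_trans ?_ (mul_meas_ge_le_lintegral (measurable_of_countable F) t)
  gcongr t * ?_
  exact measure_mono fun n hn => le_of_lt (Set.mem_ofPred.1 hn)

theorem weak_type_two {K : ℤ → ℂ} {A : ℝ≥0} (hA : L2BoundedZ K A) (t : ℝ≥0) (f : ℤ →₀ ℂ) :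
    t ^ 2 * Measure.count {n | t < ‖convZ K f n‖ₑ} ≤ A * ∑' n, ‖f n‖ₑ ^ 2 := by
  refine le_trans ?_ (hA f)
  refine le_trans ?_ (mul_count_le_tsum _ ((t : ℝ≥0∞) ^ 2))
  gcongr _ * ?_
  exact measure_mono fun n hn => ENNReal.pow_lt_pow_left two_ne_zero (Set.mem_ofPred.1 hn)

theorem weak_type_one {K : ℤ → ℂ} {A B : ℝ≥0} (hA : L2BoundedZ K A) (hK : HormanderZ K B)
    {t : ℝ≥0} (ht : 0 < t) (f : ℤ →₀ ℂ) :
    t * Measure.count {n | 2 * t < ‖convZ K f n‖ₑ} ≤ (2 * A + 4 + 2 * B) * ∑' n, ‖f n‖ₑ := by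
  obtain ⟨I, g, b, E, hfe, -, hg, hgn, hE, hb⟩ := exists_hasCZDecomp hK ht f
  have ht0 : (t : ℝ≥0∞) ≠ 0 := by exact_mod_cast ht.ne'
  have hsub : {n | 2 * t < ‖convZ K f n‖ₑ} ⊆ {n | t < ‖convZ K g n‖ₑ} ∪ (E : Set ℤ) ∪
      {n | t < (E : Set ℤ)ᶜ.indicator (fun n => ‖convZ K b n‖ₑ) n} := by
    intro n hn
    simp only [Set.mem_union, Set.mem_ofPred_eq] at hn ⊢
    by_contra! h
    obtain ⟨⟨h1, h2⟩, h3⟩ := h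
    rw [Set.indicator_of_mem (by exact h2)] at h3
    refine absurd hn (not_lt.2 ?_)
    rw [hfe, map_add, two_mul]
    exact (enorm_add_le _ _).trans (add_le_add h1 h3)
  have h1 : t * Measure.count {n | t < ‖convZ K g n‖ₑ} ≤ 2 * A * ∑' n, ‖f n‖ₑ := by
    refine (ENNReal.mul_le_mul_iff_right ht0 (by simp)).1 ?_
    calc (t : ℝ≥0∞) * (t * Measure.count {n | t < ‖convZ K g n‖ₑ})
        = t ^ 2 * Measure.count {n | t < ‖convZ K g n‖ₑ} := by ring
      _ ≤ A * ∑' n, ‖g n‖ₑ ^ 2 := weak_type_two hA t g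
      _ ≤ A * ∑' n, (2 * t) * ‖g n‖ₑ := by
          gcongr with n
          rw [sq]
          gcongr
          exact hg n
      _ ≤ A * ((2 * t) * ∑' n, ‖f n‖ₑ) := by
          rw [ENNReal.tsum_mul_left]; gcongr
      _ = _ := by ring
  have h2 : t * Measure.count (E : Set ℤ) ≤ 4 * ∑' n, ‖f n‖ₑ := by
    rw [Measure.count_apply_finset]; exact hE
  have h3 := (mul_count_le_tsum _ (t : ℝ≥0∞)).trans hb
  calc t * Measure.count {n | 2 * t < ‖convZ K f n‖ₑ}
      ≤ t * (Measure.count {n | t < ‖convZ K g n‖ₑ} + Measure.count (E : Set ℤ) +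
        Measure.count {n | t < (E : Set ℤ)ᶜ.indicator (fun n => ‖convZ K b n‖ₑ) n}) := by
        gcongr
        refine (measure_mono hsub).trans ((measure_union_le _ _).trans ?_)
        gcongr
        exact measure_union_le _ _
    _ ≤ 2 * A * ∑' n, ‖f n‖ₑ + 4 * ∑' n, ‖f n‖ₑ + 2 * B * ∑' n, ‖f n‖ₑ := by
        rw [mul_add, mul_add]
        gcongr
    _ = _ := by ring

theorem setLIntegral_Iio_rpow {r s : ℝ} (hr : 0 ≤ r) (hs : -1 < s) :
    ∫⁻ t in Set.Ioo 0 r, ENNReal.ofReal (t ^ s) = ENNReal.ofReal (r ^ (s + 1) / (s + 1)) := by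
  rw [← ofReal_integral_eq_lintegral_ofReal]
  · rw [← integral_Ioc_eq_integral_Ioo, ← intervalIntegral.integral_of_le hr,
      integral_rpow (.inl hs), Real.zero_rpow (by linarith), sub_zero]
  · rcases hr.eq_or_lt with rfl | hr
    · simp
    · exact (intervalIntegral.integrableOn_Ioo_rpow_iff hr).2 hs
  · filter_upwards [ae_restrict_mem measurableSet_Ioo] with t ht
    exact Real.rpow_nonneg ht.1.le _

theorem setLIntegral_Ioi_rpow {r s : ℝ} (hr : 0 < r) (hs : s < -1) :
    ∫⁻ t in Set.Ioi r, ENNReal.ofReal (t ^ s) = ENNReal.ofReal (-r ^ (s + 1) / (s + 1)) := by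
  rw [← ofReal_integral_eq_lintegral_ofReal (integrableOn_Ioi_rpow_of_lt hs hr),
    integral_Ioi_rpow_of_lt hs hr]
  filter_upwards [ae_restrict_mem measurableSet_Ioi] with t ht
  exact Real.rpow_nonneg (hr.trans ht).le _

theorem count_convZ_mul_rpow_le {K : ℤ → ℂ} {A B : ℝ≥0} (hA : L2BoundedZ K A)
    (hK : HormanderZ K B) (p : ℝ) (f : ℤ →₀ ℂ) {t : ℝ} (ht : 0 < t) :
    Measure.count {n | t < ‖convZ K f n‖ / 3} * ENNReal.ofReal (t ^ (p - 1)) ≤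
      ∑ n ∈ f.support, ((2 * A + 4 + 2 * B) * ‖f n‖ₑ *
          (Set.Iio ‖f n‖).indicator (fun t => ENNReal.ofReal (t ^ (p - 2))) t +
        A * ‖f n‖ₑ ^ 2 * (Set.Ici ‖f n‖).indicator (fun t => ENNReal.ofReal (t ^ (p - 3))) t) := by
  set s : ℝ≥0 := ⟨t, ht.le⟩ with hs
  have hs0 : 0 < s := ht
  set f₁ := f.filter (fun n => t < ‖f n‖) with hf₁
  set f₂ := f.filter (fun n => ¬ t < ‖f n‖) with hf₂
  have hf : f = f₁ + f₂ := (Finsupp.filter_add_filter_not f _).symm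
  have hse : (s : ℝ≥0∞) = ENNReal.ofReal t := by
    rw [ENNReal.ofReal, Real.toNNReal_of_nonneg ht.le]
    rfl
  have hsub : {n | t < ‖convZ K f n‖ / 3} ⊆
      {n | 2 * s < ‖convZ K f₁ n‖ₑ} ∪ {n | s < ‖convZ K f₂ n‖ₑ} := by
    intro n hn
    have hn' : t < ‖convZ K f n‖ / 3 := hn
    by_contra h
    simp only [Set.mem_union, Set.mem_ofPred_eq, not_or, not_lt] at h
    obtain ⟨h1, h2⟩ := h
    have : ‖convZ K f n‖ₑ ≤ 3 * s := by
      rw [hf, map_add]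
      refine (enorm_add_le _ _).trans ((add_le_add h1 h2).trans (le_of_eq ?_))
      ring
    have : ‖convZ K f n‖ ≤ 3 * t := by
      rw [enorm_eq_nnnorm] at this
      exact_mod_cast this
    linarith
  have hp1 : ENNReal.ofReal (t ^ (p - 1)) = s * ENNReal.ofReal (t ^ (p - 2)) := by
    rw [hse, ← ENNReal.ofReal_mul ht.le, show p - 1 = 1 + (p - 2) by ring, Real.rpow_add ht,
      Real.rpow_one]
  have hp2 : ENNReal.ofReal (t ^ (p - 1)) = s ^ 2 * ENNReal.ofReal (t ^ (p - 3)) := by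
    rw [hse, ← ENNReal.ofReal_pow ht.le, ← ENNReal.ofReal_mul (by positivity),
      show p - 1 = (2 : ℕ) + (p - 3) by push_cast; ring, Real.rpow_add ht, Real.rpow_natCast]
  have hsupp : ∀ n ∉ f.support, f n = 0 := fun n hn => by simpa using hn
  have e₁ : (∑' n, ‖f₁ n‖ₑ) * ENNReal.ofReal (t ^ (p - 2)) = ∑ n ∈ f.support,
      ‖f n‖ₑ * (Set.Iio ‖f n‖).indicator (fun t => ENNReal.ofReal (t ^ (p - 2))) t := by
    rw [tsum_eq_sum (s := f.support) (fun n hn => by simp [hf₁, Finsupp.filter_apply, hsupp n hn]),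
      Finset.sum_mul]
    refine Finset.sum_congr rfl fun n _ => ?_
    by_cases h : t < ‖f n‖ <;> simp [hf₁, h]
  have e₂ : (∑' n, ‖f₂ n‖ₑ ^ 2) * ENNReal.ofReal (t ^ (p - 3)) = ∑ n ∈ f.support,
      ‖f n‖ₑ ^ 2 * (Set.Ici ‖f n‖).indicator (fun t => ENNReal.ofReal (t ^ (p - 3))) t := by
    rw [tsum_eq_sum (s := f.support) (fun n hn => by simp [hf₂, Finsupp.filter_apply, hsupp n hn]),
      Finset.sum_mul]
    refine Finset.sum_congr rfl fun n _ => ?_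
    by_cases h : t < ‖f n‖
    · simp [hf₂, h]
    · simp [hf₂, not_lt.1 h]
  simp only [mul_assoc, Finset.sum_add_distrib, ← Finset.mul_sum]
  rw [← e₁, ← e₂]
  calc Measure.count {n | t < ‖convZ K f n‖ / 3} * ENNReal.ofReal (t ^ (p - 1))
      ≤ (Measure.count {n | 2 * s < ‖convZ K f₁ n‖ₑ} + Measure.count {n | s < ‖convZ K f₂ n‖ₑ}) *
          ENNReal.ofReal (t ^ (p - 1)) := by
        gcongr
        exact (measure_mono hsub).trans (measure_union_le _ _)
    _ = (s * Measure.count {n | 2 * s < ‖convZ K f₁ n‖ₑ}) * ENNReal.ofReal (t ^ (p - 2)) +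
        (s ^ 2 * Measure.count {n | s < ‖convZ K f₂ n‖ₑ}) * ENNReal.ofReal (t ^ (p - 3)) := by
        rw [add_mul]
        nth_rw 1 [hp1]
        rw [hp2]
        ring
    _ ≤ ((2 * A + 4 + 2 * B) * ∑' n, ‖f₁ n‖ₑ) * ENNReal.ofReal (t ^ (p - 2)) +
        (A * ∑' n, ‖f₂ n‖ₑ ^ 2) * ENNReal.ofReal (t ^ (p - 3)) := by
        gcongr ?_ * _ + ?_ * _
        · exact weak_type_one hA hK hs0 f₁
        · exact weak_type_two hA s f₂
    _ = _ := by rw [mul_assoc, mul_assoc]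

/-- `ℓᵖ` boundedness, with `p`-th power constant `C`, of convolution with `K`. -/
def LpBoundedZ (K : ℤ → ℂ) (p : ℝ) (C : ℝ≥0) : Prop :=
  ∀ f : ℤ →₀ ℂ, ∑' n : ℤ, ‖convZ K f n‖ₑ ^ p ≤ C * ∑' n : ℤ, ‖f n‖ₑ ^ p

theorem LpBoundedZ.of_lt_two {K : ℤ → ℂ} {A B : ℝ≥0} (hA : L2BoundedZ K A) (hK : HormanderZ K B)
    {p : ℝ} (hp : 1 < p) (hp2 : p < 2) :
    ∃ C, LpBoundedZ K p C := by
  refine ⟨Real.toNNReal (3 ^ p) * (p.toNNReal * ((2 * A + 4 + 2 * B) * (p - 1)⁻¹.toNNReal +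
    A * (2 - p)⁻¹.toNNReal)), fun f => ?_⟩
  have hp0 : 0 < p := by linarith
  have hlayer := lintegral_rpow_eq_lintegral_meas_lt_mul (μ := Measure.count)
    (f := fun n => ‖convZ K f n‖ / 3) (.of_forall fun n => by positivity)
    (measurable_of_countable _).aemeasurable hp0
  have hrp : ∀ x : ℂ, ‖x‖ₑ ^ p = ENNReal.ofReal (‖x‖ ^ p) := by
    intro x
    rw [← ofReal_norm, ENNReal.ofReal_rpow_of_nonneg (norm_nonneg _) hp0.le]
  have hlhs : ∑' n : ℤ, ‖convZ K f n‖ₑ ^ p = ENNReal.ofReal (3 ^ p) *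
      ∫⁻ n, ENNReal.ofReal ((‖convZ K f n‖ / 3) ^ p) ∂Measure.count := by
    rw [lintegral_count, ← ENNReal.tsum_mul_left]
    refine tsum_congr fun n => ?_
    rw [hrp, ← ENNReal.ofReal_mul (by positivity), ← Real.mul_rpow (by norm_num) (by positivity)]
    congr 2
    ring
  have hint : ∫⁻ t in Set.Ioi (0 : ℝ), Measure.count {n | t < ‖convZ K f n‖ / 3} *
      ENNReal.ofReal (t ^ (p - 1)) ≤ ∑ n ∈ f.support,
        ((2 * A + 4 + 2 * B) * ((p - 1)⁻¹.toNNReal : ℝ≥0∞) + A * ((2 - p)⁻¹.toNNReal : ℝ≥0∞)) *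
          ‖f n‖ₑ ^ p := by
    refine (setLIntegral_mono' measurableSet_Ioi
      fun t ht => count_convZ_mul_rpow_le hA hK p f ht).trans ?_
    rw [lintegral_finsetSum' _ (fun n _ => by fun_prop (disch := measurability))]
    refine Finset.sum_le_sum fun n hn => ?_
    have hn0 : 0 < ‖f n‖ := norm_pos_iff.2 (Finsupp.mem_support_iff.1 hn)
    rw [lintegral_add_left (by measurability), lintegral_const_mul _ (by measurability),
      lintegral_const_mul _ (by measurability), lintegral_indicator measurableSet_Iio,
      lintegral_indicator measurableSet_Ici, Measure.restrict_restrict measurableSet_Iio,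
      Measure.restrict_restrict measurableSet_Ici, Set.Iio_inter_Ioi,
      Set.inter_eq_left.2 (Set.Ici_subset_Ioi.2 hn0),
      setLIntegral_congr Ioi_ae_eq_Ici.symm,
      setLIntegral_Iio_rpow hn0.le (by linarith), setLIntegral_Ioi_rpow hn0 (by linarith)]
    have hr1 : ‖f n‖ₑ * ENNReal.ofReal (‖f n‖ ^ (p - 2 + 1) / (p - 2 + 1)) =
        ENNReal.ofReal (p - 1)⁻¹ * ‖f n‖ₑ ^ p := by
      rw [hrp, ← ofReal_norm, ← ENNReal.ofReal_mul (by positivity),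
        ← ENNReal.ofReal_mul (inv_nonneg.2 (by linarith))]
      congr 1
      have : ‖f n‖ ^ p = ‖f n‖ * ‖f n‖ ^ (p - 2 + 1) := by
        conv_lhs => rw [show p = 1 + (p - 2 + 1) by ring, Real.rpow_add hn0, Real.rpow_one]
      rw [this, show p - 2 + 1 = p - 1 by ring]
      ring
    have hr2 : ‖f n‖ₑ ^ 2 * ENNReal.ofReal (-‖f n‖ ^ (p - 3 + 1) / (p - 3 + 1)) =
        ENNReal.ofReal (2 - p)⁻¹ * ‖f n‖ₑ ^ p := by
      rw [hrp, ← ofReal_norm, ← ENNReal.ofReal_pow (by positivity),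
        ← ENNReal.ofReal_mul (by positivity), ← ENNReal.ofReal_mul (inv_nonneg.2 (by linarith))]
      congr 1
      have : ‖f n‖ ^ p = ‖f n‖ ^ 2 * ‖f n‖ ^ (p - 3 + 1) := by
        conv_lhs => rw [show p = (2 : ℕ) + (p - 3 + 1) by push_cast; ring, Real.rpow_add hn0,
          Real.rpow_natCast]
      rw [this, show p - 3 + 1 = -(2 - p) by ring, div_neg, neg_div, neg_neg]
      ring
    rw [mul_assoc, hr1, mul_assoc (A : ℝ≥0∞), hr2]
    exact le_of_eq (by simp only [ENNReal.ofReal]; ring)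
  rw [hlhs, hlayer]
  push_cast
  rw [mul_assoc, mul_assoc]
  refine mul_le_mul_right (mul_le_mul_right (hint.trans ?_) _) _
  rw [← Finset.mul_sum]
  gcongr
  exact ENNReal.sum_le_tsum _

theorem LpBoundedZ.of_eq_two {K : ℤ → ℂ} {A : ℝ≥0} (hA : L2BoundedZ K A) : LpBoundedZ K 2 A := by
  intro f
  simpa only [ENNReal.rpow_ofNat] using hA f

theorem sum_mul_convZ (K : ℤ → ℂ) (f g : ℤ →₀ ℂ) :
    ∑ n ∈ g.support, g n * convZ K f n = ∑ k ∈ f.support,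
      f k * convZ K (g.mapDomain (Equiv.neg ℤ)) (-k) := by
  have h : ∀ k, convZ K (g.mapDomain (Equiv.neg ℤ)) (-k) =
      ∑ n ∈ g.support, g n * K (n - k) := by
    intro k
    rw [convZ_apply, Finsupp.sum_mapDomain_index (by simp) (by intros; ring)]
    refine Finset.sum_congr rfl fun n _ => ?_
    simp only [Equiv.neg_apply]
    congr 2
    ring
  simp only [h, convZ_apply, Finsupp.sum, Finset.mul_sum]
  rw [Finset.sum_comm]
  refine Finset.sum_congr rfl fun k _ => Finset.sum_congr rfl fun n _ => ?_
  ring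

theorem LpBoundedZ.of_conjExponent {K : ℤ → ℂ} {p q : ℝ} (hpq : p.HolderConjugate q) {C : ℝ≥0}
    (hq : LpBoundedZ K q C) : LpBoundedZ K p (C ^ (p / q)) := by
  intro f
  have hp0 : 0 < p := hpq.pos
  have hq0 : 0 < q := hpq.symm.pos
  set u := convZ K f with hu
  set F : ℝ≥0∞ := ∑' n, ‖f n‖ₑ ^ p with hF
  rw [ENNReal.tsum_eq_iSup_sum]
  refine iSup_le fun S => ?_
  set X : ℝ≥0∞ := ∑ n ∈ S, ‖u n‖ₑ ^ p with hX
  let g : ℤ →₀ ℂ := Finsupp.indicator S fun n _ => starRingEnd ℂ (u n) * ((‖u n‖ ^ (p - 2) : ℝ) : ℂ)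
  have hg : ∀ n ∈ S, g n = starRingEnd ℂ (u n) * ((‖u n‖ ^ (p - 2) : ℝ) : ℂ) := by
    intro n hn; simp [g, Finsupp.indicator_apply, hn]
  have hg' : ∀ n ∉ S, g n = 0 := by
    intro n hn; simp [g, Finsupp.indicator_apply, hn]
  have hgs : g.support ⊆ S := Finsupp.support_indicator_subset _ _
  have hgu : ∀ n ∈ S, g n * u n = ((‖u n‖ ^ p : ℝ) : ℂ) := by
    intro n hn
    rw [hg n hn]
    rcases eq_or_ne (u n) 0 with h | h
    · simp [h, Real.zero_rpow hp0.ne']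
    · have h0 : 0 < ‖u n‖ := norm_pos_iff.2 h
      rw [mul_right_comm, Complex.conj_mul', ← Complex.ofReal_pow, ← Complex.ofReal_mul,
        ← Real.rpow_natCast, ← Real.rpow_add h0]
      congr 2
      push_cast
      ring
  have hgn : ∀ n ∈ S, ‖g n‖ₑ ^ q = ‖u n‖ₑ ^ p := by
    intro n hn
    rcases eq_or_ne (u n) 0 with h | h
    · simp [hg n hn, h, hp0, hq0]
    · have h0 : 0 < ‖u n‖ := norm_pos_iff.2 h
      rw [← ofReal_norm, ← ofReal_norm, ENNReal.ofReal_rpow_of_nonneg (norm_nonneg _) hq0.le,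
        ENNReal.ofReal_rpow_of_nonneg (norm_nonneg _) hp0.le, hg n hn]
      congr 1
      rw [norm_mul, RCLike.norm_conj, Complex.norm_real, Real.norm_of_nonneg (by positivity)]
      nth_rw 1 [← Real.rpow_one ‖u n‖]
      rw [← Real.rpow_add h0, ← Real.rpow_mul h0.le]
      congr 1
      have := hpq.mul_eq_add
      linarith
  have hXsum : X = ‖∑ n ∈ g.support, g n * u n‖ₑ := by
    rw [Finset.sum_subset hgs (fun n _ hn => by simp [Finsupp.notMem_support_iff.1 hn]),
      Finset.sum_congr rfl hgu, ← Complex.ofReal_sum, ← ofReal_norm, Complex.norm_real,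
      Real.norm_of_nonneg (Finset.sum_nonneg fun _ _ => by positivity),
      ENNReal.ofReal_sum_of_nonneg (fun _ _ => by positivity)]
    refine Finset.sum_congr rfl fun n _ => ?_
    rw [← ofReal_norm, ENNReal.ofReal_rpow_of_nonneg (norm_nonneg _) hp0.le]
  have hneg : ∑ n ∈ f.support, ‖convZ K (g.mapDomain (Equiv.neg ℤ)) (-n)‖ₑ ^ q ≤ C * X := by
    refine (ENNReal.sum_le_tsum _).trans ?_
    refine ((Equiv.neg ℤ).tsum_eq
      (fun n => ‖convZ K (g.mapDomain (Equiv.neg ℤ)) n‖ₑ ^ q)).trans_le ?_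
    refine (hq _).trans (le_of_eq ?_)
    congr 1
    rw [← (Equiv.neg ℤ).tsum_eq, hX, tsum_eq_sum (s := S)]
    · refine Finset.sum_congr rfl fun n hn => ?_
      rw [Finsupp.mapDomain_apply (Equiv.neg ℤ).injective, hgn n hn]
    · intro n hn
      rw [Finsupp.mapDomain_apply (Equiv.neg ℤ).injective, hg' n hn]
      simp [hq0]
  have hXle : X ≤ F ^ (1 / p) * (C * X) ^ (1 / q) := by
    calc X ≤ ∑ k ∈ f.support, ‖f k‖ₑ * ‖convZ K (g.mapDomain (Equiv.neg ℤ)) (-k)‖ₑ := by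
          rw [hXsum, sum_mul_convZ]
          refine (enorm_sum_le _ _).trans (le_of_eq ?_)
          simp only [enorm_mul]
      _ ≤ _ := ENNReal.inner_le_Lp_mul_Lq _ _ _ hpq
      _ ≤ _ := by
          gcongr
          exact ENNReal.sum_le_tsum _
  have hXtop : X ≠ ∞ := by
    rw [hX]
    exact ENNReal.sum_ne_top.2 fun n _ => ENNReal.rpow_ne_top_of_nonneg hp0.le enorm_ne_top
  rcases eq_or_ne X 0 with h0 | h0
  · rw [h0]; exact zero_le
  have hsplit : X = X ^ (1 / p) * X ^ (1 / q) := by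
    rw [← ENNReal.rpow_add _ _ h0 hXtop]
    have := hpq.inv_add_inv_eq_one
    rw [one_div, one_div, this, ENNReal.rpow_one]
  have hcancel : X ^ (1 / p) ≤ F ^ (1 / p) * (C : ℝ≥0∞) ^ (1 / q) := by
    rw [ENNReal.mul_rpow_of_nonneg _ _ (by positivity), ← mul_assoc] at hXle
    nth_rw 1 [hsplit] at hXle
    refine (ENNReal.mul_le_mul_iff_left ?_ ?_).1 hXle
    · simp [h0, hXtop]
    · exact ENNReal.rpow_ne_top_of_nonneg (by positivity) hXtop
  have := ENNReal.rpow_le_rpow hcancel hp0.le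
  rw [ENNReal.mul_rpow_of_nonneg _ _ hp0.le, ← ENNReal.rpow_mul, ← ENNReal.rpow_mul,
    ← ENNReal.rpow_mul, one_div_mul_cancel hp0.ne', ENNReal.rpow_one, ENNReal.rpow_one,
    one_div_mul_eq_div, mul_comm] at this
  rwa [ENNReal.coe_rpow_of_nonneg _ (by positivity)]

/-- The Calderón–Zygmund theorem on `ℤ` for finitely supported functions. -/
theorem exists_LpBoundedZ {K : ℤ → ℂ} {A B : ℝ≥0} (hA : L2BoundedZ K A) (hK : HormanderZ K B)
    {p : ℝ} (hp : 1 < p) : ∃ C, LpBoundedZ K p C := by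
  rcases lt_trichotomy p 2 with h | rfl | h
  · exact LpBoundedZ.of_lt_two hA hK hp h
  · exact ⟨A, .of_eq_two hA⟩
  · have hpq := Real.HolderConjugate.conjExponent hp
    obtain ⟨C, hC⟩ := LpBoundedZ.of_lt_two hA hK hpq.symm.lt (by
      rw [Real.conjExponent, div_lt_iff₀ (by linarith)]; linarith)
    exact ⟨_, hC.of_conjExponent hpq⟩

/-- Convolution bounds pass from finitely supported to summable functions. -/
theorem LpBoundedZ.tsum_le {K : ℤ → ℂ} {p : ℝ} (hp : 0 < p) {C : ℝ≥0} (h : LpBoundedZ K p C)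
    {R : ℝ} (hR : ∀ n, ‖K n‖ ≤ R) {f : ℤ → ℂ} (hf : Summable fun n => ‖f n‖) :
    ∑' n : ℤ, ‖∑' k : ℤ, f k * K (n - k)‖ₑ ^ p ≤ C * ∑' n : ℤ, ‖f n‖ₑ ^ p := by
  rw [ENNReal.tsum_eq_iSup_sum]
  refine iSup_le fun S => ?_
  have hsum : ∀ n, Summable fun k => f k * K (n - k) := by
    intro n
    refine Summable.of_norm_bounded (hf.mul_right R) fun k => ?_
    rw [norm_mul]
    exact mul_le_mul_of_nonneg_left (hR _) (norm_nonneg _)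
  have hlim : Filter.Tendsto (fun J : Finset ℤ => ∑ n ∈ S, ‖∑ k ∈ J, f k * K (n - k)‖ₑ ^ p)
      Filter.atTop (nhds (∑ n ∈ S, ‖∑' k : ℤ, f k * K (n - k)‖ₑ ^ p)) := by
    refine tendsto_finsetSum _ fun n _ => ?_
    exact ((hsum n).hasSum.enorm).ennrpow_const p
  refine le_of_tendsto' hlim fun J => ?_
  let fJ : ℤ →₀ ℂ := Finsupp.indicator J fun n _ => f n
  have hfJ : ∀ n, fJ n = if n ∈ J then f n else 0 := by
    intro n; simp [fJ, Finsupp.indicator_apply]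
  have hconv : ∀ n, convZ K fJ n = ∑ k ∈ J, f k * K (n - k) := by
    intro n
    rw [convZ_apply, Finsupp.sum_of_support_subset _ (Finsupp.support_indicator_subset _ _) _
      (by simp)]
    refine Finset.sum_congr rfl fun k hk => ?_
    rw [hfJ, if_pos hk]
  simp only [← hconv]
  refine (ENNReal.sum_le_tsum _).trans ((h fJ).trans ?_)
  gcongr with n
  rw [hfJ]
  split_ifs <;> simp

/-- The character `ξ ↦ e^{2πi nξ}`. -/
noncomputable def charZ (n : ℤ) (ξ : ℝ) : ℂ :=
  Complex.exp (2 * Real.pi * Complex.I * (n : ℂ) * (ξ : ℂ))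

theorem charZ_add (m n : ℤ) (ξ : ℝ) : charZ (m + n) ξ = charZ m ξ * charZ n ξ := by
  rw [charZ, charZ, charZ, ← Complex.exp_add]
  push_cast
  ring_nf

@[simp] theorem charZ_zero (ξ : ℝ) : charZ 0 ξ = 1 := by simp [charZ]

@[simp] theorem norm_charZ (n : ℤ) (ξ : ℝ) : ‖charZ n ξ‖ = 1 := by
  rw [charZ, show 2 * (π : ℂ) * I * n * ξ = ((2 * π * n * ξ : ℝ) : ℂ) * I by push_cast; ring]
  exact Complex.norm_exp_ofReal_mul_I _

theorem hasDerivAt_charZ (n : ℤ) (ξ : ℝ) :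
    HasDerivAt (charZ n) (2 * π * I * n * charZ n ξ) ξ := by
  have h := ((Complex.ofRealCLM.hasDerivAt (x := ξ)).const_mul (2 * (π : ℂ) * I * n)).cexp
  convert h using 1
  · rfl
  · simp [charZ]
    ring

theorem continuous_charZ (n : ℤ) : Continuous (charZ n) := by
  unfold charZ; fun_prop

/-- The `n`-th Fourier coefficient of a function on `(0,1)`. -/
noncomputable def fourierZ (u : ℝ → ℂ) (n : ℤ) : ℂ :=
  ∫ ξ in Set.Ioo (0 : ℝ) 1, u ξ * charZ (-n) ξ

theorem fourierCoeffOn_eq_fourierZ (u : ℝ → ℂ) (n : ℤ) :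
    fourierCoeffOn (zero_lt_one' ℝ) u n = fourierZ u n := by
  rw [fourierCoeffOn_eq_integral, fourierZ, intervalIntegral.integral_of_le zero_le_one,
    integral_Ioc_eq_integral_Ioo]
  simp only [sub_zero, ne_eq, one_ne_zero, not_false_eq_true, div_self, one_smul, smul_eq_mul]
  congr 1
  ext ξ
  rw [mul_comm]
  congr 1
  rw [fourier_coe_apply, charZ]
  simp

theorem integrableOn_mul_charZ {u : ℝ → ℂ} (hu : IntegrableOn u (Set.Ioo 0 1)) (n : ℤ) :
    IntegrableOn (fun ξ => u ξ * charZ n ξ) (Set.Ioo 0 1) :=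
  hu.mul_bdd (c := 1) (continuous_charZ n).aestronglyMeasurable
    (.of_forall fun ξ => (norm_charZ n ξ).le)

theorem fourierZ_mul_charZ (u : ℝ → ℂ) (n k : ℤ) :
    fourierZ (fun ξ => u ξ * charZ k ξ) n = fourierZ u (n - k) := by
  simp only [fourierZ, mul_assoc, ← charZ_add]
  congr! 4
  ring

theorem hasSum_sq_fourierZ {u : ℝ → ℂ} (hu : MemLp u 2 (volume.restrict (Set.Ioo 0 1))) :
    HasSum (fun n => ‖fourierZ u n‖ ^ 2) (∫ ξ in Set.Ioo (0 : ℝ) 1, ‖u ξ‖ ^ 2) := by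
  rw [restrict_Ioo_eq_restrict_Ioc] at hu
  have := hasSum_sq_fourierCoeffOn (zero_lt_one' ℝ) hu
  simp only [fourierCoeffOn_eq_fourierZ] at this
  rwa [sub_zero, inv_one, one_smul, intervalIntegral.integral_of_le zero_le_one,
    integral_Ioc_eq_integral_Ioo] at this

theorem tsum_enorm_sq_fourierZ {u : ℝ → ℂ} (hu : MemLp u 2 (volume.restrict (Set.Ioo 0 1))) :
    ∑' n, ‖fourierZ u n‖ₑ ^ 2 = ENNReal.ofReal (∫ ξ in Set.Ioo (0 : ℝ) 1, ‖u ξ‖ ^ 2) := by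
  have h := hasSum_sq_fourierZ hu
  rw [← h.tsum_eq, ENNReal.ofReal_tsum_of_nonneg (fun _ => by positivity) h.summable]
  refine tsum_congr fun n => ?_
  rw [← ofReal_norm, ENNReal.ofReal_pow (norm_nonneg _)]

theorem fourierZ_one (n : ℤ) : fourierZ (fun _ => 1) n = if n = 0 then 1 else 0 := by
  simp only [fourierZ, one_mul]
  split_ifs with h
  · simp [h]
  · rw [← integral_Ioc_eq_integral_Ioo, ← intervalIntegral.integral_of_le zero_le_one]
    have hc : 2 * π * I * ((-n : ℤ) : ℂ) ≠ 0 := by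
      simp [h, Real.pi_ne_zero]
    simp only [charZ]
    rw [integral_exp_mul_complex hc]
    have : Complex.exp (2 * π * I * ((-n : ℤ) : ℂ) * ((1 : ℝ) : ℂ)) = 1 := by
      rw [Complex.exp_eq_one_iff]
      exact ⟨-n, by push_cast; ring⟩
    rw [this]
    simp

theorem convZ_fourierZ {u : ℝ → ℂ} (hu : IntegrableOn u (Set.Ioo 0 1)) (f : ℤ →₀ ℂ) (n : ℤ) :
    convZ (fourierZ u) f n = fourierZ (fun ξ => u ξ * ∑ k ∈ f.support, f k * charZ k ξ) n := by
  have h : ∀ k, f k * fourierZ u (n - k) =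
      ∫ ξ in Set.Ioo (0 : ℝ) 1, f k * (u ξ * charZ k ξ * charZ (-n) ξ) := by
    intro k
    rw [integral_const_mul, ← fourierZ_mul_charZ, fourierZ]
  rw [convZ_apply, Finsupp.sum, Finset.sum_congr rfl fun k _ => h k, ← integral_finsetSum, fourierZ]
  · congr 1
    ext ξ
    simp only [Finset.mul_sum, Finset.sum_mul]
    refine Finset.sum_congr rfl fun k _ => by ring
  · intro k _
    exact (integrableOn_mul_charZ (integrableOn_mul_charZ hu k) (-n)).const_mul _

theorem memLp_two_of_bound {u : ℝ → ℂ} {M : ℝ}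
    (hm : AEStronglyMeasurable u (volume.restrict (Set.Ioo 0 1)))
    (hM : ∀ ξ ∈ Set.Ioo (0 : ℝ) 1, ‖u ξ‖ ≤ M) : MemLp u 2 (volume.restrict (Set.Ioo 0 1)) :=
  .of_bound hm M ((ae_restrict_mem measurableSet_Ioo).mono hM)

theorem l2BoundedZ_fourierZ {u : ℝ → ℂ} {M : ℝ≥0}
    (hm : AEStronglyMeasurable u (volume.restrict (Set.Ioo 0 1)))
    (hM : ∀ ξ ∈ Set.Ioo (0 : ℝ) 1, ‖u ξ‖ ≤ M) : L2BoundedZ (fourierZ u) (M ^ 2) := by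
  intro f
  have hu2 := memLp_two_of_bound hm hM
  have hu : IntegrableOn u (Set.Ioo 0 1) := hu2.integrable one_le_two
  set P : ℝ → ℂ := fun ξ => ∑ k ∈ f.support, f k * charZ k ξ with hP
  have hPc : Continuous P := by
    have := continuous_charZ
    fun_prop
  have hPb : ∀ ξ, ‖P ξ‖ ≤ ∑ k ∈ f.support, ‖f k‖ := by
    intro ξ
    refine (norm_sum_le _ _).trans (le_of_eq ?_)
    simp
  have hP2 : MemLp P 2 (volume.restrict (Set.Ioo 0 1)) :=
    memLp_two_of_bound hPc.aestronglyMeasurable fun ξ _ => hPb ξ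
  have huP : MemLp (fun ξ => u ξ * P ξ) 2 (volume.restrict (Set.Ioo 0 1)) := by
    refine memLp_two_of_bound (M := M * ∑ k ∈ f.support, ‖f k‖)
      (hm.mul hPc.aestronglyMeasurable) fun ξ hξ => ?_
    rw [norm_mul]
    exact mul_le_mul (hM ξ hξ) (hPb ξ) (norm_nonneg _) M.2
  have hf : ∀ n, fourierZ P n = f n := by
    intro n
    have := convZ_fourierZ (u := fun _ => 1) (by simp) f n
    simp only [one_mul] at this
    rw [← this, convZ_apply, Finsupp.sum]
    simp only [fourierZ_one, sub_eq_zero, mul_ite, mul_one, mul_zero, Finset.sum_ite_eq]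
    simp +contextual [eq_comm]
  have hfP := tsum_enorm_sq_fourierZ hP2
  simp only [hf] at hfP
  simp only [convZ_fourierZ hu]
  rw [tsum_enorm_sq_fourierZ huP, hfP]
  have : ((M ^ 2 : ℝ≥0) : ℝ≥0∞) = ENNReal.ofReal ((M : ℝ) ^ 2) := by
    rw [← NNReal.coe_pow, ENNReal.ofReal_coe_nnreal]
  rw [this, ← ENNReal.ofReal_mul (by positivity), ← integral_const_mul]
  refine ENNReal.ofReal_le_ofReal ?_
  refine setIntegral_mono_on huP.integrable_norm_pow' (hP2.integrable_norm_pow'.const_mul _)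
    measurableSet_Ioo fun ξ hξ => ?_
  rw [norm_mul, mul_pow]
  gcongr
  exact hM ξ hξ

theorem tsum_indicator_inv_sq_le {L : ℕ} (hL : 0 < L) :
    ∑' n : ℤ, {n : ℤ | (L : ℤ) ≤ |n|}.indicator (fun n => ENNReal.ofReal (((n : ℝ) ^ 2)⁻¹)) n ≤
      ENNReal.ofReal (8 / L) := by
  have hN : ∑' n : ℕ, {n : ℕ | L ≤ n}.indicator (fun n => ENNReal.ofReal (((n : ℝ) ^ 2)⁻¹)) n ≤
      ENNReal.ofReal (4 / L) := by
    refine ENNReal.tsum_le_of_sum_range_le fun N => ?_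
    rw [Finset.sum_indicator_eq_sum_filter, ← ENNReal.ofReal_sum_of_nonneg (fun _ _ => by positivity)]
    refine ENNReal.ofReal_le_ofReal ?_
    have h1 := sum_Ioo_inv_sq_le (α := ℝ) L N
    have h2 : Finset.filter (fun n => n ∈ {n : ℕ | L ≤ n}) (Finset.range N) ⊆
        insert L (Finset.Ioo L N) := by
      intro n hn
      simp only [Finset.mem_filter, Finset.mem_range, Set.mem_ofPred_eq] at hn
      simp only [Finset.mem_insert, Finset.mem_Ioo]
      omega
    refine (Finset.sum_le_sum_of_subset_of_nonneg h2 fun _ _ _ => by positivity).trans ?_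
    rw [Finset.sum_insert (by simp)]
    have hL' : (1 : ℝ) ≤ L := by exact_mod_cast hL
    have h3 : ((L : ℝ) ^ 2)⁻¹ ≤ 1 / L := by
      rw [inv_le_comm₀ (by positivity) (by positivity)]
      field_simp
      exact hL'
    have h4 : 2 / ((L : ℝ) + 1) ≤ 2 / L := by gcongr; linarith
    have h5 : (4 : ℝ) / L = 1 / L + 2 / L + 1 / L := by ring
    have h6 : (0 : ℝ) ≤ 1 / L := by positivity
    linarith
  rw [HasSum.tsum_eq (HasSum.of_nat_of_neg_add_one (f := {n : ℤ | (L : ℤ) ≤ |n|}.indicator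
    (fun n => ENNReal.ofReal (((n : ℝ) ^ 2)⁻¹))) ENNReal.summable.hasSum ENNReal.summable.hasSum)]
  have h8 : ENNReal.ofReal (8 / L) = ENNReal.ofReal (4 / L) + ENNReal.ofReal (4 / L) := by
    rw [← ENNReal.ofReal_add (by positivity) (by positivity)]
    congr 1; ring
  rw [h8]
  refine add_le_add (le_trans (le_of_eq ?_) hN) (le_trans ?_ hN)
  · refine tsum_congr fun n => ?_
    simp [Set.indicator_apply]
  · rw [tsum_eq_zero_add' (f := {n : ℕ | L ≤ n}.indicator _) ENNReal.summable]
    refine le_trans (le_of_eq ?_) (le_add_self)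
    refine tsum_congr fun n => ?_
    have h9 : |(-((n : ℤ) + 1))| = n + 1 := by rw [abs_neg, abs_of_nonneg (by positivity)]
    simp only [Set.indicator_apply, Set.mem_ofPred_eq, h9]
    have : ((L : ℤ) ≤ n + 1) ↔ L ≤ n + 1 := by omega
    simp only [this]
    push_cast
    rw [neg_sq]

theorem fourierZ_eq_of_hasDerivAt {u u' : ℝ → ℂ} (hu : ContinuousOn u (Set.Icc 0 1))
    (h01 : u 0 = u 1) (hd : ∀ ξ ∈ Set.Ioo (0 : ℝ) 1, HasDerivAt u (u' ξ) ξ)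
    (hu' : IntegrableOn u' (Set.Ioo 0 1)) {n : ℤ} (hn : n ≠ 0) :
    fourierZ u n = (2 * π * I * n)⁻¹ * fourierZ u' n := by
  have h := fourierCoeffOn_of_hasDerivAt_Ioo (zero_lt_one' ℝ) hn
    (by rwa [Set.uIcc_of_le zero_le_one]) (by simpa using hd)
    ((intervalIntegrable_iff_integrableOn_Ioo_of_le zero_le_one).2 hu')
  rw [fourierCoeffOn_eq_fourierZ, fourierCoeffOn_eq_fourierZ] at h
  rw [h, h01]
  have : (n : ℂ) ≠ 0 := by exact_mod_cast hn
  simp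

/-- If `u` is periodic and `‖u'‖₂² ≤ D L`, then the Fourier coefficients of `u` have an absolutely
summable tail outside `[-L, L]`, with a bound that does not depend on `L`. -/
theorem tsum_indicator_fourierZ_le {u u' : ℝ → ℂ} (hu : ContinuousOn u (Set.Icc 0 1))
    (h01 : u 0 = u 1) (hd : ∀ ξ ∈ Set.Ioo (0 : ℝ) 1, HasDerivAt u (u' ξ) ξ)
    (hu' : MemLp u' 2 (volume.restrict (Set.Ioo 0 1))) {D : ℝ} {L : ℕ} (hL : 0 < L)
    (hD : ∫ ξ in Set.Ioo (0 : ℝ) 1, ‖u' ξ‖ ^ 2 ≤ D * L) :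
    ∑' n : ℤ, {n : ℤ | (L : ℤ) ≤ |n|}.indicator (fun n => ‖fourierZ u n‖ₑ) n ≤
      ENNReal.ofReal (D + 8) := by
  have hL' : (0 : ℝ) < L := by exact_mod_cast hL
  have hD0 : 0 ≤ D := by
    have : 0 ≤ D * L := le_trans (by positivity) hD
    exact nonneg_of_mul_nonneg_left this hL'
  have key : ∀ n : ℤ, {n : ℤ | (L : ℤ) ≤ |n|}.indicator (fun n => ‖fourierZ u n‖ₑ) n ≤
      ENNReal.ofReal (L : ℝ)⁻¹ * ‖fourierZ u' n‖ₑ ^ 2 + ENNReal.ofReal L *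
        {n : ℤ | (L : ℤ) ≤ |n|}.indicator (fun n => ENNReal.ofReal (((n : ℝ) ^ 2)⁻¹)) n := by
    intro n
    by_cases hn : (L : ℤ) ≤ |n|
    · have hn0 : n ≠ 0 := by rintro rfl; simp at hn; omega
      have hn0' : (n : ℝ) ≠ 0 := by exact_mod_cast hn0
      rw [Set.indicator_of_mem (by simpa using hn), Set.indicator_of_mem (by simpa using hn),
        fourierZ_eq_of_hasDerivAt hu h01 hd (hu'.integrable one_le_two) hn0, ← ofReal_norm,
        ← ofReal_norm, ← ENNReal.ofReal_pow (norm_nonneg _), ← ENNReal.ofReal_mul (by positivity),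
        ← ENNReal.ofReal_mul (by positivity), ← ENNReal.ofReal_add (by positivity) (by positivity)]
      refine ENNReal.ofReal_le_ofReal ?_
      set x := ‖fourierZ u' n‖ 
      have hx : 0 ≤ x := norm_nonneg _
      have hn1 : 0 < |(n : ℝ)| := abs_pos.2 hn0'
      have e1 : ‖(2 * π * I * n : ℂ)⁻¹ * fourierZ u' n‖ ≤ |(n : ℝ)|⁻¹ * x := by
        rw [norm_mul]
        refine mul_le_mul_of_nonneg_right ?_ hx
        rw [norm_inv]
        simp only [norm_mul, Complex.norm_I, Complex.norm_real, Complex.norm_ofNat, mul_one,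
          Complex.norm_intCast, Real.norm_eq_abs, abs_of_pos Real.pi_pos]
        refine inv_anti₀ hn1 ?_
        nlinarith [Real.pi_gt_three]
      refine e1.trans ?_
      rw [← sq_abs (n : ℝ)]
      set y := |(n : ℝ)|⁻¹
      have hy : (|(n : ℝ)| ^ 2)⁻¹ = y ^ 2 := by rw [inv_pow]
      rw [hy]
      have : (L : ℝ)⁻¹ * x ^ 2 + L * y ^ 2 - y * x = L * ((y - (L : ℝ)⁻¹ * x / 2) ^ 2) +
        3 / 4 * ((L : ℝ)⁻¹ * x ^ 2) := by field_simp; ring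
      have h1 : 0 ≤ L * ((y - (L : ℝ)⁻¹ * x / 2) ^ 2) + 3 / 4 * ((L : ℝ)⁻¹ * x ^ 2) := by
        positivity
      linarith
    · rw [Set.indicator_of_notMem (by simpa using hn)]
      exact zero_le
  refine (ENNReal.tsum_le_tsum key).trans ?_
  rw [ENNReal.tsum_add, ENNReal.tsum_mul_left, ENNReal.tsum_mul_left, tsum_enorm_sq_fourierZ hu',
    ENNReal.ofReal_add hD0 (by norm_num)]
  refine add_le_add ?_ ?_
  · rw [← ENNReal.ofReal_mul (by positivity)]
    refine ENNReal.ofReal_le_ofReal ?_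
    rw [inv_mul_le_iff₀ hL', mul_comm]
    exact hD
  · refine (mul_le_mul_right (tsum_indicator_inv_sq_le hL) _).trans ?_
    rw [← ENNReal.ofReal_mul (by positivity)]
    refine ENNReal.ofReal_le_ofReal (le_of_eq ?_)
    field_simp

theorem norm_one_sub_charZ_one (ξ : ℝ) : ‖1 - charZ 1 ξ‖ = |2 * Real.sin (π * ξ)| := by
  have h := Complex.norm_exp_I_mul_ofReal_sub_one (2 * π * ξ)
  rw [norm_sub_rev, charZ]
  rw [Real.norm_eq_abs, show 2 * π * ξ / 2 = π * ξ by ring] at h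
  rw [← h]
  congr 3
  push_cast
  ring

theorem norm_one_sub_charZ_one_mem {ξ : ℝ} (hξ : ξ ∈ Set.Icc (0 : ℝ) 1) :
    ‖1 - charZ 1 ξ‖ ∈ Set.Icc (ξ * (1 - ξ)) (13 * (ξ * (1 - ξ))) := by
  have key : ∀ x : ℝ, 0 ≤ x → x ≤ 1 / 2 →
      |2 * Real.sin (π * x)| ∈ Set.Icc (x * (1 - x)) (13 * (x * (1 - x))) := by
    intro x hx0 hx1
    have hpi := Real.pi_pos
    have h1 := Real.mul_le_sin (x := π * x) (by positivity) (by nlinarith)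
    have h2 := Real.sin_le (x := π * x) (by positivity)
    have h3 : 2 / π * (π * x) = 2 * x := by field_simp
    rw [h3] at h1
    have h4 := Real.pi_lt_d2
    rw [abs_of_nonneg (by linarith)]
    constructor
    · nlinarith
    · nlinarith [mul_nonneg hx0 (by linarith : 0 ≤ 1 / 2 - x)]
  rw [norm_one_sub_charZ_one]
  rcases le_total ξ (1 / 2) with h | h
  · exact key ξ hξ.1 h
  · have := key (1 - ξ) (by linarith [hξ.2]) (by linarith)
    rw [show π * (1 - ξ) = π - π * ξ by ring, Real.sin_pi_sub] at this
    rwa [sub_sub_cancel, mul_comm (1 - ξ)] at this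

theorem norm_one_sub_charZ_le (k : ℕ) (ξ : ℝ) :
    ‖1 - charZ k ξ‖ ≤ k * ‖1 - charZ 1 ξ‖ := by
  induction k with
  | zero => simp
  | succ k ih =>
    have : 1 - charZ (k + 1 : ℕ) ξ = (1 - charZ k ξ) + charZ k ξ * (1 - charZ 1 ξ) := by
      push_cast
      rw [charZ_add]
      ring
    rw [this]
    refine (norm_add_le _ _).trans ?_
    rw [norm_mul, norm_charZ]
    push_cast
    linarith

/-- The smooth cutoff `1 / (1 + L (1 - e^{2πiξ}))` to frequencies at distance `≲ 1 / L` from `ℤ`. -/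
noncomputable def cutoffZ (L : ℕ) (ξ : ℝ) : ℂ := (1 + L * (1 - charZ 1 ξ))⁻¹

theorem one_add_sq_le_norm_sq (L : ℕ) (ξ : ℝ) :
    1 + (L * ‖1 - charZ 1 ξ‖) ^ 2 ≤ ‖1 + L * (1 - charZ 1 ξ)‖ ^ 2 := by
  have hre : 0 ≤ (1 - charZ 1 ξ).re := by
    have := Complex.re_le_norm (charZ 1 ξ)
    rw [norm_charZ] at this
    simpa using this
  have h : ‖1 + L * (1 - charZ 1 ξ)‖ ^ 2 =
      1 + (L * ‖1 - charZ 1 ξ‖) ^ 2 + 2 * (L * (1 - charZ 1 ξ).re) := by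
    rw [mul_pow, ← Complex.normSq_eq_norm_sq, ← Complex.normSq_eq_norm_sq, Complex.normSq_apply,
      Complex.normSq_apply]
    simp
    ring
  rw [h]
  have : (0 : ℝ) ≤ 2 * (L * (1 - charZ 1 ξ).re) := by positivity
  linarith

theorem one_add_ne_zero (L : ℕ) (ξ : ℝ) : (1 + L * (1 - charZ 1 ξ) : ℂ) ≠ 0 := by
  intro h
  have := one_add_sq_le_norm_sq L ξ
  rw [h] at this
  simp at this
  nlinarith [sq_nonneg (L * ‖1 - charZ 1 ξ‖)]

theorem norm_cutoffZ_sq_le (L : ℕ) (ξ : ℝ) :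
    ‖cutoffZ L ξ‖ ^ 2 ≤ (1 + (L * ‖1 - charZ 1 ξ‖) ^ 2)⁻¹ := by
  rw [cutoffZ, norm_inv, inv_pow]
  exact inv_anti₀ (by positivity) (one_add_sq_le_norm_sq L ξ)

theorem norm_cutoffZ_le_one (L : ℕ) (ξ : ℝ) : ‖cutoffZ L ξ‖ ≤ 1 := by
  have h := norm_cutoffZ_sq_le L ξ
  have h1 : (1 + (L * ‖1 - charZ 1 ξ‖) ^ 2)⁻¹ ≤ (1 : ℝ) :=
    inv_le_one_of_one_le₀ (by linarith [sq_nonneg (L * ‖1 - charZ 1 ξ‖)])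
  exact (sq_le_one_iff₀ (norm_nonneg _)).1 (h.trans h1)

theorem norm_mul_cutoffZ_le_one (L : ℕ) (ξ : ℝ) : ‖L * (1 - charZ 1 ξ) * cutoffZ L ξ‖ ≤ 1 := by
  have h := norm_cutoffZ_sq_le L ξ
  rw [norm_mul, norm_mul, Complex.norm_natCast]
  set t := L * ‖1 - charZ 1 ξ‖
  rw [← sq_le_one_iff₀ (by positivity), mul_pow]
  calc t ^ 2 * ‖cutoffZ L ξ‖ ^ 2 ≤ t ^ 2 * (1 + t ^ 2)⁻¹ := by gcongr
    _ ≤ 1 := by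
      rw [mul_inv_le_iff₀ (by positivity)]
      linarith

theorem one_sub_cutoffZ (L : ℕ) (ξ : ℝ) :
    1 - cutoffZ L ξ = L * (1 - charZ 1 ξ) * cutoffZ L ξ := by
  have := one_add_ne_zero L ξ
  rw [cutoffZ]
  field_simp
  ring

theorem hasDerivAt_cutoffZ (L : ℕ) (ξ : ℝ) :
    HasDerivAt (cutoffZ L) (L * (2 * π * I * charZ 1 ξ) * cutoffZ L ξ ^ 2) ξ := by
  have h := ((((hasDerivAt_charZ 1 ξ).const_sub 1).const_mul (L : ℂ)).const_add 1).inv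
    (one_add_ne_zero L ξ)
  refine HasDerivAt.congr_deriv (f := cutoffZ L) h ?_
  simp only [cutoffZ]
  push_cast
  rw [inv_pow, div_eq_mul_inv]
  ring

theorem continuous_cutoffZ (L : ℕ) : Continuous (cutoffZ L) :=
  continuous_iff_continuousAt.2 fun ξ => (hasDerivAt_cutoffZ L ξ).continuousAt

theorem integral_norm_cutoffZ_sq_le {L : ℕ} (hL : 0 < L) :
    ∫ ξ in Set.Ioo (0 : ℝ) 1, ‖cutoffZ L ξ‖ ^ 2 ≤ 2 * π / L := by
  have hL' : (0 : ℝ) < L := by exact_mod_cast hL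
  set G : ℝ → ℝ := fun x => (1 + (L / 2 * x) ^ 2)⁻¹ with hG
  have hGc : Continuous G := by
    refine Continuous.inv₀ (by fun_prop) fun x => ?_
    positivity
  have hGi : ∫ x in (0 : ℝ)..1, G x ≤ π / L := by
    have := intervalIntegral.integral_comp_mul_left (a := 0) (b := 1)
      (fun x : ℝ => (1 + x ^ 2)⁻¹) (c := L / 2) (by positivity)
    rw [hG, this, integral_inv_one_add_sq]
    simp only [mul_zero, mul_one, Real.arctan_zero, sub_zero, smul_eq_mul]
    have := (Real.arctan_lt_pi_div_two (L / 2)).le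
    calc ((L : ℝ) / 2)⁻¹ * Real.arctan (L / 2) ≤ ((L : ℝ) / 2)⁻¹ * (π / 2) := by gcongr
      _ = π / L := by field_simp
  have hGi' : ∫ x in (0 : ℝ)..1, G (1 - x) ≤ π / L := by
    rw [intervalIntegral.integral_comp_sub_left G 1]
    simpa using hGi
  rw [← integral_Ioc_eq_integral_Ioo, ← intervalIntegral.integral_of_le zero_le_one]
  have hGc' : Continuous fun x => G (1 - x) := by fun_prop
  calc ∫ ξ in (0 : ℝ)..1, ‖cutoffZ L ξ‖ ^ 2 ≤ ∫ ξ in (0 : ℝ)..1, (G ξ + G (1 - ξ)) := by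
        refine intervalIntegral.integral_mono_on zero_le_one
          (((continuous_cutoffZ L).norm.pow 2).intervalIntegrable _ _)
          ((hGc.add hGc').intervalIntegrable _ _) fun ξ hξ => ?_
        refine (norm_cutoffZ_sq_le L ξ).trans ?_
        have hz := (norm_one_sub_charZ_one_mem hξ).1
        have hG0 : ∀ x, 0 ≤ G x := fun x => by simp only [hG]; positivity
        have aux : ∀ x : ℝ, 0 ≤ x → x / 2 ≤ ‖1 - charZ 1 ξ‖ →
            (1 + (L * ‖1 - charZ 1 ξ‖) ^ 2)⁻¹ ≤ G x := by
          intro x hx h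
          refine inv_anti₀ (by positivity) ?_
          have : L / 2 * x ≤ L * ‖1 - charZ 1 ξ‖ := by nlinarith
          gcongr
        rcases le_total ξ (1 / 2) with h | h
        · have := aux ξ hξ.1 (by nlinarith [hξ.1])
          linarith [hG0 (1 - ξ)]
        · have := aux (1 - ξ) (by linarith [hξ.2]) (by nlinarith [hξ.2])
          linarith [hG0 ξ]
    _ = (∫ ξ in (0 : ℝ)..1, G ξ) + ∫ ξ in (0 : ℝ)..1, G (1 - ξ) :=
        intervalIntegral.integral_add (hGc.intervalIntegrable _ _) (hGc'.intervalIntegrable _ _)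
    _ ≤ π / L + π / L := add_le_add hGi hGi'
    _ = 2 * π / L := by ring

/-- A bounded function `ν` on `(0,1)` with derivative `ν'` satisfying
`ξ (1 - ξ) ‖ν' ξ‖ ≤ c`. -/
structure MikhlinZ (ν ν' : ℝ → ℂ) (M c : ℝ≥0) : Prop where
  hasDerivAt : ∀ ξ ∈ Set.Ioo (0 : ℝ) 1, HasDerivAt ν (ν' ξ) ξ
  aestronglyMeasurable : AEStronglyMeasurable ν' (volume.restrict (Set.Ioo 0 1))
  norm_le : ∀ ξ ∈ Set.Ioo (0 : ℝ) 1, ‖ν ξ‖ ≤ M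
  norm_deriv_le : ∀ ξ ∈ Set.Ioo (0 : ℝ) 1, ξ * (1 - ξ) * ‖ν' ξ‖ ≤ c

theorem MikhlinZ.continuousOn {ν ν' : ℝ → ℂ} {M c : ℝ≥0} (hν : MikhlinZ ν ν' M c) :
    ContinuousOn ν (Set.Ioo 0 1) :=
  fun ξ hξ => (hν.hasDerivAt ξ hξ).continuousAt.continuousWithinAt

theorem MikhlinZ.measurable {ν ν' : ℝ → ℂ} {M c : ℝ≥0} (hν : MikhlinZ ν ν' M c) :
    AEStronglyMeasurable ν (volume.restrict (Set.Ioo 0 1)) :=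
  hν.continuousOn.aestronglyMeasurable measurableSet_Ioo

/-- Fourier tail of a Mikhlin multiplier times a function localised by `cutoffZ L`. -/
theorem MikhlinZ.tsum_tail_le {ν ν' : ℝ → ℂ} {M c : ℝ≥0} (hν : MikhlinZ ν ν' M c)
    {h h' : ℝ → ℂ} (hh : ∀ ξ, HasDerivAt h (h' ξ) ξ) (hc' : Continuous h') {L : ℕ} (hL : 0 < L)
    {E : ℝ} (hE : 0 ≤ E)
    (hb : ∀ ξ ∈ Set.Icc (0 : ℝ) 1, ‖h ξ‖ ≤ E * L * (ξ * (1 - ξ)) * ‖cutoffZ L ξ‖)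
    (hb' : ∀ ξ ∈ Set.Icc (0 : ℝ) 1, ‖h' ξ‖ ≤ E * L * ‖cutoffZ L ξ‖) :
    ∑' n : ℤ, {n : ℤ | (L : ℤ) ≤ |n|}.indicator
      (fun n => ‖fourierZ (fun ξ => ν ξ * h ξ) n‖ₑ) n ≤
      ENNReal.ofReal (((c + M) * E) ^ 2 * (2 * π) + 8) := by
  have hL' : (0 : ℝ) < L := by exact_mod_cast hL
  have hc : Continuous h := continuous_iff_continuousAt.2 fun ξ => (hh ξ).continuousAt
  have h0 : h 0 = 0 := by simpa using hb 0 (by simp)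
  have h1 : h 1 = 0 := by simpa using hb 1 (by simp)
  have hd : ∀ ξ ∈ Set.Ioo (0 : ℝ) 1,
      HasDerivAt (fun ξ => ν ξ * h ξ) (ν' ξ * h ξ + ν ξ * h' ξ) ξ :=
    fun ξ hξ => (hν.hasDerivAt ξ hξ).mul (hh ξ)
  have hub : ∀ ξ ∈ Set.Icc (0 : ℝ) 1, ‖ν ξ * h ξ‖ ≤ M * (E * L * (ξ * (1 - ξ))) := by
    intro ξ hξ
    rcases hξ.1.eq_or_lt with rfl | h2
    · simp [h0]
    rcases hξ.2.eq_or_lt with rfl | h3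
    · simp [h1]
    rw [norm_mul]
    have h4 : 0 ≤ E * L * (ξ * (1 - ξ)) :=
      mul_nonneg (by positivity) (mul_nonneg hξ.1 (by linarith [hξ.2]))
    refine mul_le_mul (hν.norm_le ξ ⟨h2, h3⟩) ?_ (norm_nonneg _) M.2
    exact (hb ξ hξ).trans (mul_le_of_le_one_right h4 (norm_cutoffZ_le_one L ξ))
  have hcu : ContinuousOn (fun ξ => ν ξ * h ξ) (Set.Icc 0 1) := by
    have hend : ∀ x : ℝ, x * (1 - x) = 0 → h x = 0 →
        ContinuousWithinAt (fun ξ => ν ξ * h ξ) (Set.Icc 0 1) x := by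
      intro x hx hhx
      rw [ContinuousWithinAt, hhx, mul_zero]
      refine squeeze_zero_norm' (eventually_mem_nhdsWithin.mono hub) ?_
      have : Continuous fun ξ : ℝ => (M : ℝ) * (E * L * (ξ * (1 - ξ))) := by fun_prop
      have := (this.tendsto x).mono_left (nhdsWithin_le_nhds (s := Set.Icc 0 1))
      simpa [hx] using this
    intro x hx
    rcases hx.1.eq_or_lt with rfl | h2
    · exact hend _ (by simp) h0
    rcases hx.2.eq_or_lt with rfl | h3
    · exact hend _ (by simp) h1
    exact (hd x ⟨h2, h3⟩).continuousAt.continuousWithinAt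
  have hu'b : ∀ ξ ∈ Set.Ioo (0 : ℝ) 1,
      ‖ν' ξ * h ξ + ν ξ * h' ξ‖ ≤ (c + M) * E * L * ‖cutoffZ L ξ‖ := by
    intro ξ hξ
    have hξ' := Set.Ioo_subset_Icc_self hξ
    have hx : 0 ≤ E * L * ‖cutoffZ L ξ‖ := by positivity
    calc ‖ν' ξ * h ξ + ν ξ * h' ξ‖ ≤ ‖ν' ξ‖ * ‖h ξ‖ + ‖ν ξ‖ * ‖h' ξ‖ := by
          rw [← norm_mul, ← norm_mul]; exact norm_add_le _ _
      _ ≤ ‖ν' ξ‖ * (E * L * (ξ * (1 - ξ)) * ‖cutoffZ L ξ‖) +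
          M * (E * L * ‖cutoffZ L ξ‖) := by
          refine add_le_add (mul_le_mul_of_nonneg_left (hb ξ hξ') (norm_nonneg _)) ?_
          exact mul_le_mul (hν.norm_le ξ hξ) (hb' ξ hξ') (norm_nonneg _) M.2
      _ = (ξ * (1 - ξ) * ‖ν' ξ‖) * (E * L * ‖cutoffZ L ξ‖) +
          M * (E * L * ‖cutoffZ L ξ‖) := by ring
      _ ≤ c * (E * L * ‖cutoffZ L ξ‖) + M * (E * L * ‖cutoffZ L ξ‖) := by
          gcongr
          exact hν.norm_deriv_le ξ hξ
      _ = _ := by ring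
  have hmu' : MemLp (fun ξ => ν' ξ * h ξ + ν ξ * h' ξ) 2 (volume.restrict (Set.Ioo 0 1)) := by
    refine memLp_two_of_bound (M := (c + M) * E * L)
      ((hν.aestronglyMeasurable.mul hc.aestronglyMeasurable).add
        (hν.measurable.mul hc'.aestronglyMeasurable)) fun ξ hξ => (hu'b ξ hξ).trans ?_
    exact mul_le_of_le_one_right (by positivity) (norm_cutoffZ_le_one L ξ)
  refine tsum_indicator_fourierZ_le hcu (by simp [h0, h1]) hd hmu' hL ?_
  have hi : IntegrableOn (fun ξ => ‖cutoffZ L ξ‖ ^ 2) (Set.Ioo 0 1) :=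
    (((continuous_cutoffZ L).norm.pow 2).integrableOn_Icc (a := 0) (b := 1)).mono_set
      Set.Ioo_subset_Icc_self
  calc ∫ ξ in Set.Ioo (0 : ℝ) 1, ‖ν' ξ * h ξ + ν ξ * h' ξ‖ ^ 2
      ≤ ∫ ξ in Set.Ioo (0 : ℝ) 1, ((c + M) * E * L) ^ 2 * ‖cutoffZ L ξ‖ ^ 2 := by
        refine setIntegral_mono_on hmu'.integrable_norm_pow' (hi.const_mul _) measurableSet_Ioo
          fun ξ hξ => ?_
        rw [← mul_pow]
        exact pow_le_pow_left₀ (norm_nonneg _) (hu'b ξ hξ) 2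
    _ ≤ ((c + M) * E * L) ^ 2 * (2 * π / L) := by
        rw [integral_const_mul]
        gcongr
        exact integral_norm_cutoffZ_sq_le hL
    _ = ((c + M) * E) ^ 2 * (2 * π) * L := by field_simp

theorem MikhlinZ.hormanderZ {ν ν' : ℝ → ℂ} {M c : ℝ≥0} (hν : MikhlinZ ν ν' M c) :
    ∃ B, HormanderZ (fourierZ ν) B := by
  set T : ℝ≥0∞ := ENNReal.ofReal (((c + M) * 20) ^ 2 * (2 * π) + 8) with hT
  refine ⟨(3 * T).toNNReal, fun L hL y hy hyL => ?_⟩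
  rw [ENNReal.coe_toNNReal (ENNReal.mul_ne_top (by simp) ENNReal.ofReal_ne_top)]
  lift y to ℕ using hy
  have hyL' : (y : ℝ) ≤ L := by exact_mod_cast hyL.le
  have hp : 2 * π ≤ 7 := by linarith [Real.pi_lt_d2]
  have hIν : IntegrableOn ν (Set.Ioo 0 1) :=
    (memLp_two_of_bound hν.measurable hν.norm_le).integrable one_le_two
  set h₁ : ℝ → ℂ := fun ξ => cutoffZ L ξ * (1 - charZ y ξ) with hh₁
  set h₂ : ℝ → ℂ := fun ξ => 1 - cutoffZ L ξ with hh₂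
  have nderiv : ∀ ξ, ‖L * (2 * π * I * charZ 1 ξ) * cutoffZ L ξ ^ 2‖ ≤
      2 * π * L * ‖cutoffZ L ξ‖ * ‖cutoffZ L ξ‖ := by
    intro ξ
    simp only [norm_mul, norm_pow, norm_charZ, Complex.norm_I, Complex.norm_natCast,
      Complex.norm_real, Complex.norm_ofNat, Real.norm_eq_abs, abs_of_pos Real.pi_pos]
    exact le_of_eq (by ring)
  have hz : ∀ ξ ∈ Set.Icc (0 : ℝ) 1, ‖1 - charZ 1 ξ‖ ≤ 20 * (ξ * (1 - ξ)) := by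
    intro ξ hξ
    have := (norm_one_sub_charZ_one_mem hξ).2
    have : 0 ≤ ξ * (1 - ξ) := mul_nonneg hξ.1 (by linarith [hξ.2])
    linarith
  have hyz : ∀ ξ, ‖1 - charZ y ξ‖ ≤ L * ‖1 - charZ 1 ξ‖ := fun ξ =>
    (norm_one_sub_charZ_le y ξ).trans (by gcongr)
  have t₁ := hν.tsum_tail_le (h := h₁) (E := 20)
    (fun ξ => (hasDerivAt_cutoffZ L ξ).mul ((hasDerivAt_charZ y ξ).const_sub 1))
    (by
      have := continuous_cutoffZ L
      have := continuous_charZ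
      fun_prop) hL (by norm_num)
    (by
      intro ξ hξ
      rw [hh₁, norm_mul]
      calc ‖cutoffZ L ξ‖ * ‖1 - charZ y ξ‖ ≤ ‖cutoffZ L ξ‖ * (L * (20 * (ξ * (1 - ξ)))) := by
            gcongr
            exact (hyz ξ).trans (by gcongr; exact hz ξ hξ)
        _ = _ := by ring)
    (by
      intro ξ hξ
      have e1 : ‖cutoffZ L ξ‖ * ‖1 - charZ y ξ‖ ≤ 1 := by
        refine le_trans ?_ (norm_mul_cutoffZ_le_one L ξ)
        rw [mul_comm, norm_mul, norm_mul, Complex.norm_natCast]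
        gcongr
        exact hyz ξ
      refine (norm_add_le _ _).trans ?_
      rw [norm_mul]
      have e2 : ‖cutoffZ L ξ * -(2 * π * I * (y : ℤ) * charZ y ξ)‖ ≤
          2 * π * L * ‖cutoffZ L ξ‖ := by
        simp only [norm_mul, norm_neg, norm_charZ, Complex.norm_I, Complex.norm_intCast,
          Complex.norm_real, Complex.norm_ofNat, Real.norm_eq_abs, abs_of_pos Real.pi_pos]
        simp only [Int.cast_natCast, Nat.abs_cast, mul_one]
        rw [mul_comm]
        gcongr
      have e3 : 2 * π * L * ‖cutoffZ L ξ‖ * (‖cutoffZ L ξ‖ * ‖1 - charZ y ξ‖) ≤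
          2 * π * L * ‖cutoffZ L ξ‖ := mul_le_of_le_one_right (by positivity) e1
      have e4 : 2 * π * (L * ‖cutoffZ L ξ‖) ≤ 7 * (L * ‖cutoffZ L ξ‖) := by gcongr
      have e5 := mul_le_mul_of_nonneg_right (nderiv ξ) (norm_nonneg (1 - charZ y ξ))
      have e6 : 0 ≤ L * ‖cutoffZ L ξ‖ := by positivity
      nlinarith)
  have t₂ := hν.tsum_tail_le (h := h₂) (E := 20)
    (fun ξ => (hasDerivAt_cutoffZ L ξ).const_sub 1)
    (by
      have := continuous_cutoffZ L
      have := continuous_charZ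
      fun_prop) hL (by norm_num)
    (by
      intro ξ hξ
      simp only [hh₂]
      rw [one_sub_cutoffZ, norm_mul, norm_mul, Complex.norm_natCast]
      calc L * ‖1 - charZ 1 ξ‖ * ‖cutoffZ L ξ‖ ≤ L * (20 * (ξ * (1 - ξ))) * ‖cutoffZ L ξ‖ := by
            gcongr
            exact hz ξ hξ
        _ = _ := by ring)
    (by
      intro ξ hξ
      rw [norm_neg]
      refine (nderiv ξ).trans ?_
      refine (mul_le_of_le_one_right (by positivity) (norm_cutoffZ_le_one L ξ)).trans ?_
      gcongr
      linarith)
  rw [← hT] at t₁ t₂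
  set F₁ := fourierZ fun ξ => ν ξ * h₁ ξ
  set F₂ := fourierZ fun ξ => ν ξ * h₂ ξ
  have hcont₁ : Continuous h₁ := by
    have := continuous_cutoffZ L
    have := continuous_charZ
    fun_prop
  have hcont₂ : Continuous h₂ := by
    have := continuous_cutoffZ L
    fun_prop
  have hbdd : ∀ h : ℝ → ℂ, Continuous h → (∀ ξ, ‖h ξ‖ ≤ 2) →
      IntegrableOn (fun ξ => ν ξ * h ξ) (Set.Ioo 0 1) := fun h hc hb =>
    hIν.mul_bdd (c := 2) hc.aestronglyMeasurable (.of_forall hb)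
  have hchar : ∀ ξ, ‖1 - charZ y ξ‖ ≤ 2 := fun ξ => by
    refine (norm_sub_le _ _).trans ?_
    rw [norm_one, norm_charZ]; norm_num
  have hI₁ := hbdd h₁ hcont₁ fun ξ => by
    rw [hh₁, norm_mul]
    exact (mul_le_mul (norm_cutoffZ_le_one L ξ) (hchar ξ) (norm_nonneg _) zero_le_one).trans
      (by norm_num)
  have hI₂ := hbdd h₂ hcont₂ fun ξ => by
    refine (norm_sub_le _ _).trans ?_
    rw [norm_one]; linarith [norm_cutoffZ_le_one L ξ]
  have hdecomp : ∀ n : ℤ, fourierZ ν (n - y) - fourierZ ν n = F₂ (n - y) - F₂ n - F₁ n := by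
    intro n
    simp only [F₁, F₂]
    rw [← fourierZ_mul_charZ ν, ← fourierZ_mul_charZ (fun ξ => ν ξ * h₂ ξ)]
    simp only [fourierZ]
    rw [← integral_sub, ← integral_sub, ← integral_sub]
    · congr 1
      ext ξ
      simp only [hh₁, hh₂]
      ring
    · exact (integrableOn_mul_charZ (integrableOn_mul_charZ hI₂ _) _).sub
        (integrableOn_mul_charZ hI₂ _)
    · exact integrableOn_mul_charZ hI₁ _
    · exact integrableOn_mul_charZ (integrableOn_mul_charZ hI₂ _) _
    · exact integrableOn_mul_charZ hI₂ _
    · exact integrableOn_mul_charZ (integrableOn_mul_charZ hIν _) _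
    · exact integrableOn_mul_charZ hIν _
  set S : Set ℤ := {n : ℤ | (L : ℤ) ≤ |n|} with hS
  have key : ∀ n : ℤ, {n : ℤ | 2 * (L : ℤ) ≤ |n|}.indicator
      (fun n => ‖fourierZ ν (n - y) - fourierZ ν n‖ₑ) n ≤
      S.indicator (fun n => ‖F₂ n‖ₑ) (n - y) + S.indicator (fun n => ‖F₂ n‖ₑ) n +
        S.indicator (fun n => ‖F₁ n‖ₑ) n := by
    intro n
    by_cases hn : 2 * (L : ℤ) ≤ |n|
    · have hn1 : n ∈ S := by simp only [hS, Set.mem_ofPred_eq]; omega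
      have hn2 : n - y ∈ S := by
        simp only [hS, Set.mem_ofPred_eq]
        rcases abs_cases n with h | h <;> rcases abs_cases (n - y) with h' | h' <;> omega
      rw [Set.indicator_of_mem (by simpa using hn), Set.indicator_of_mem hn1,
        Set.indicator_of_mem hn1, Set.indicator_of_mem hn2, hdecomp]
      exact (enorm_sub_le).trans (add_le_add enorm_sub_le le_rfl)
    · rw [Set.indicator_of_notMem (by simpa using hn)]
      exact zero_le
  refine (ENNReal.tsum_le_tsum key).trans ?_
  have hshift := (Equiv.subRight (y : ℤ)).tsum_eq (S.indicator fun n => ‖F₂ n‖ₑ)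
  simp only [Equiv.subRight_apply] at hshift
  rw [ENNReal.tsum_add, ENNReal.tsum_add, hshift]
  calc _ ≤ T + T + T := add_le_add (add_le_add t₂ t₂) t₁
    _ = 3 * T := by ring

theorem norm_fourierZ_le {u : ℝ → ℂ} {M : ℝ} (hM : ∀ ξ ∈ Set.Ioo (0 : ℝ) 1, ‖u ξ‖ ≤ M) (n : ℤ) :
    ‖fourierZ u n‖ ≤ M := by
  have := norm_setIntegral_le_of_norm_le_const (μ := volume) (s := Set.Ioo (0 : ℝ) 1)
    (f := fun ξ => u ξ * charZ (-n) ξ) (C := M) (by simp) fun ξ hξ => by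
      simpa using hM ξ hξ
  simpa [fourierZ] using this

theorem TmultInterval_eq_tsum {a b : ℝ} {m : ℝ → ℂ}
    (hI : IntegrableOn (fun ξ => m (a + (b - a) * ξ)) (Set.Ioo 0 1))
    {f : ℤ → ℂ} (hf : Summable fun n => ‖f n‖) (n : ℤ) :
    TmultInterval a b m f n = ∑' k, f k * fourierZ (fun ξ => m (a + (b - a) * ξ)) (-n - k) := by
  have hF : ∀ k, IntegrableOn
      (fun ξ => f k * (m (a + (b - a) * ξ) * charZ (-(-n - k)) ξ)) (Set.Ioo 0 1) :=
    fun k => (integrableOn_mul_charZ hI _).const_mul _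
  simp only [fourierZ, ← integral_const_mul]
  rw [integral_tsum_of_summable_integral_norm hF]
  · rw [TmultInterval]
    congr 1
    ext ξ
    rw [dftZ, ← tsum_mul_left, ← tsum_mul_right]
    refine tsum_congr fun k => ?_
    rw [show -(-n - k) = k + n by ring, charZ_add, charZ, charZ]
    ring
  · simp only [norm_mul, norm_charZ, mul_one, integral_const_mul]
    exact hf.mul_right _

theorem lpNormZ_eq_tsum (f : ℤ → ℂ) {p : ℝ} (hp : 0 < p) :
    lpNormZ f p = (∑' n, ‖f n‖ₑ ^ p) ^ (1 / p) := by
  rw [lpNormZ, eLpNorm_eq_lintegral_rpow_enorm_toReal (by simpa using hp) ENNReal.ofReal_ne_top,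
    lintegral_count, ENNReal.toReal_ofReal hp.le]

theorem MikhlinZ.lpNormZ_TmultInterval_le {a b : ℝ} {m ν' : ℝ → ℂ} {M c : ℝ≥0}
    (hν : MikhlinZ (fun ξ => m (a + (b - a) * ξ)) ν' M c) {p : ℝ} (hp : 1 < p) :
    ∃ C : ℝ, 0 < C ∧ ∀ f : ℤ → ℂ, Summable (fun n => ‖f n‖) →
      lpNormZ (TmultInterval a b m f) p ≤ ENNReal.ofReal C * lpNormZ f p := by
  obtain ⟨B, hB⟩ := hν.hormanderZ
  obtain ⟨C, hC⟩ := exists_LpBoundedZ (l2BoundedZ_fourierZ hν.measurable hν.norm_le) hB hp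
  have hp0 : 0 < p := by linarith
  have hI := (memLp_two_of_bound hν.measurable hν.norm_le).integrable one_le_two
  refine ⟨((C ^ (1 / p) + 1 : ℝ≥0) : ℝ), by positivity, fun f hf => ?_⟩
  have h := hC.tsum_le hp0 (norm_fourierZ_le hν.norm_le) hf
  rw [← (Equiv.neg ℤ).tsum_eq] at h
  simp only [Equiv.neg_apply, ← TmultInterval_eq_tsum hI hf] at h
  rw [lpNormZ_eq_tsum _ hp0, lpNormZ_eq_tsum _ hp0, ENNReal.ofReal_coe_nnreal]
  calc _ ≤ (C * ∑' n, ‖f n‖ₑ ^ p) ^ (1 / p) := ENNReal.rpow_le_rpow h (by positivity)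
    _ = (C ^ (1 / p) : ℝ≥0) * (∑' n, ‖f n‖ₑ ^ p) ^ (1 / p) := by
      rw [ENNReal.mul_rpow_of_nonneg _ _ (by positivity),
        ENNReal.coe_rpow_of_nonneg _ (by positivity)]
    _ ≤ _ := by
      gcongr
      exact le_self_add

theorem mikhlinZ_comp_affine {a b : ℝ} (hab : a < b) {m : ℝ → ℂ} {M c : ℝ}
    (hbdd : ∀ ξ ∈ Set.Ioo a b, ‖m ξ‖ ≤ M) (hsmooth : ContDiffOn ℝ 1 m (Set.Ioo a b))
    (hderiv : ∀ ξ ∈ Set.Ioo a b, (ξ - a) * (b - ξ) * ‖deriv m ξ‖ ≤ c) :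
    MikhlinZ (fun ξ => m (a + (b - a) * ξ)) (fun ξ => (b - a : ℝ) • deriv m (a + (b - a) * ξ))
      M.toNNReal (c / (b - a)).toNNReal := by
  have hba : 0 < b - a := by linarith
  have hmem : ∀ ξ ∈ Set.Ioo (0 : ℝ) 1, a + (b - a) * ξ ∈ Set.Ioo a b := fun ξ hξ =>
    ⟨by nlinarith [mul_pos hba hξ.1], by nlinarith [mul_pos hba (sub_pos.2 hξ.2)]⟩
  refine ⟨fun ξ hξ => ?_, ?_, fun ξ hξ => ?_, fun ξ hξ => ?_⟩
  · have h1 : HasDerivAt m (deriv m (a + (b - a) * ξ)) (a + (b - a) * ξ) :=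
      ((hsmooth.differentiableOn one_ne_zero).differentiableAt
        (isOpen_Ioo.mem_nhds (hmem ξ hξ))).hasDerivAt
    have h2 : HasDerivAt (fun ξ => a + (b - a) * ξ) (b - a) ξ := by
      simpa using ((hasDerivAt_id ξ).const_mul (b - a)).const_add a
    exact h1.scomp ξ h2
  · have h3 : ContinuousOn (deriv m) (Set.Ioo a b) :=
      hsmooth.continuousOn_deriv_of_isOpen isOpen_Ioo le_rfl
    have h4 : ContinuousOn (fun ξ => deriv m (a + (b - a) * ξ)) (Set.Ioo 0 1) :=
      h3.comp (by fun_prop) hmem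
    exact (h4.aestronglyMeasurable measurableSet_Ioo).const_smul (b - a)
  · exact (hbdd _ (hmem ξ hξ)).trans (Real.le_coe_toNNReal M)
  · refine le_trans ?_ (Real.le_coe_toNNReal _)
    rw [norm_smul, Real.norm_of_nonneg hba.le, le_div_iff₀ hba]
    refine le_trans (le_of_eq ?_) (hderiv _ (hmem ξ hξ))
    ring

/-- If `m` is a bounded `C²` function on a bounded interval `(a,b)` with
`(ξ−a)^k (b−ξ)^k |m^{(k)}(ξ)| ≤ c` for `k = 0,1,2`, then `T_m^{a,b}` is bounded on
`ℓ^p(ℤ)` for all `1 < p < ∞`. -/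
theorem stmt_15 (a b : ℝ) (hab : a < b) (m : ℝ → ℂ)
    (M : ℝ) (hbdd : ∀ ξ ∈ Set.Ioo a b, ‖m ξ‖ ≤ M)
    (hsmooth : ContDiffOn ℝ 2 m (Set.Ioo a b))
    (c : ℝ) (hc : 0 < c)
    (hmik : ∀ k : ℕ, k ≤ 2 → ∀ ξ ∈ Set.Ioo a b,
      (ξ - a) ^ k * (b - ξ) ^ k * ‖iteratedDerivWithin k m (Set.Ioo a b) ξ‖ ≤ c) :
    ∀ p : ℝ, 1 < p →
      ∃ C : ℝ, 0 < C ∧ ∀ f : ℤ → ℂ, Summable (fun n => ‖f n‖) →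
        lpNormZ (TmultInterval a b m f) p ≤ ENNReal.ofReal C * lpNormZ f p := by
  intro p hp
  refine (mikhlinZ_comp_affine (c := c) hab hbdd (hsmooth.of_le one_le_two)
    fun ξ hξ => ?_).lpNormZ_TmultInterval_le hp
  have := hmik 1 one_le_two ξ hξ
  rwa [pow_one, pow_one, iteratedDerivWithin_one, derivWithin_of_isOpen isOpen_Ioo hξ] at this
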